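/- arXiv:2110.02576 — 2 statements merged into one kernel-verified Lean document; each statement's English description precedes it below -/
import Mathlib

section
/- Let T be any consistent recursively enumerable extension of PA(Ver). Then T is ΔB-DC if and only if T ⊬ ¬Con_T, where Con_T is the sentence ¬Pr_T(⌜⊥⌝). -/
namespace ModalArith

/-- Terms of the language of arithmetic L_A = {0, S, +, ×, ≤, =}. -/
inductive Term : Type
  | var : ℕ → Term
  | zero : Term
  | succ : Term → Term
  | add : Term → Term → Term
  | mul : Term → Term → Term
  deriving DecidableEq

namespace Term

/-- Free variables of a term. -/
def fv : Term → Finset ℕ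
  | var x => {x}
  | zero => ∅
  | succ t => fv t
  | add t u => fv t ∪ fv u
  | mul t u => fv t ∪ fv u

/-- Simultaneous substitution of terms for variables. -/
def substAll : Term → (ℕ → Term) → Term
  | var x, v => v x
  | zero, _ => zero
  | succ t, v => succ (substAll t v)
  | add t u, v => add (substAll t v) (substAll u v)
  | mul t u, v => mul (substAll t v) (substAll u v)

/-- Substitution of the term `s` for the variable `x`. -/
def subst (x : ℕ) (s : Term) (t : Term) : Term :=
  substAll t (Function.update Term.var x s)

/-- The numeral `n̄`. -/
def numeral : ℕ → Term
  | 0 => zero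
  | n + 1 => succ (numeral n)

/-- Value of a term in the standard model under a valuation. -/
def val : Term → (ℕ → ℕ) → ℕ
  | var x, v => v x
  | zero, _ => 0
  | succ t, v => val t v + 1
  | add t u, v => val t v + val u v
  | mul t u, v => val t v * val u v

/-- A Gödel numbering of terms. -/
def code : Term → ℕ
  | var x => Nat.pair 0 x
  | zero => Nat.pair 1 0
  | succ t => Nat.pair 2 (code t)
  | add t u => Nat.pair 3 (Nat.pair (code t) (code u))
  | mul t u => Nat.pair 4 (Nat.pair (code t) (code u))

end Term

/-- Formulas of the language L_□ of modal arithmetic. -/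
inductive Formula : Type
  | falsum : Formula
  | eq : Term → Term → Formula
  | le : Term → Term → Formula
  | and : Formula → Formula → Formula
  | or : Formula → Formula → Formula
  | imp : Formula → Formula → Formula
  | neg : Formula → Formula
  | all : ℕ → Formula → Formula
  | ex : ℕ → Formula → Formula
  | box : Formula → Formula
  deriving DecidableEq

namespace Formula

/-- Free variables of a formula. -/
def fv : Formula → Finset ℕ
  | falsum => ∅
  | eq t u => t.fv ∪ u.fv
  | le t u => t.fv ∪ u.fv
  | and φ ψ => fv φ ∪ fv ψ
  | or φ ψ => fv φ ∪ fv ψ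
  | imp φ ψ => fv φ ∪ fv ψ
  | neg φ => fv φ
  | all x φ => (fv φ).erase x
  | ex x φ => (fv φ).erase x
  | box φ => fv φ

/-- Simultaneous substitution of terms for the free variables of a formula. -/
def substAll : Formula → (ℕ → Term) → Formula
  | falsum, _ => falsum
  | eq t u, v => eq (t.substAll v) (u.substAll v)
  | le t u, v => le (t.substAll v) (u.substAll v)
  | and φ ψ, v => and (substAll φ v) (substAll ψ v)
  | or φ ψ, v => or (substAll φ v) (substAll ψ v)
  | imp φ ψ, v => imp (substAll φ v) (substAll ψ v)
  | neg φ, v => neg (substAll φ v)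
  | all x φ, v => all x (substAll φ (Function.update v x (Term.var x)))
  | ex x φ, v => ex x (substAll φ (Function.update v x (Term.var x)))
  | box φ, v => box (substAll φ v)

/-- Substitution of the term `s` for the free occurrences of the variable `x`. -/
def subst (x : ℕ) (s : Term) (φ : Formula) : Formula :=
  substAll φ (Function.update Term.var x s)

/-- The term `s` is substitutable (free) for the variable `x` in the formula. -/
def freeFor (s : Term) (x : ℕ) : Formula → Prop
  | falsum => True
  | eq _ _ => True
  | le _ _ => True
  | and φ ψ => freeFor s x φ ∧ freeFor s x ψ
  | or φ ψ => freeFor s x φ ∧ freeFor s x ψ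
  | imp φ ψ => freeFor s x φ ∧ freeFor s x ψ
  | neg φ => freeFor s x φ
  | all y φ => x = y ∨ x ∉ fv φ ∨ (y ∉ s.fv ∧ freeFor s x φ)
  | ex y φ => x = y ∨ x ∉ fv φ ∨ (y ∉ s.fv ∧ freeFor s x φ)
  | box φ => freeFor s x φ

/-- The formula is an L_A-formula (contains no □). -/
def noBox : Formula → Prop
  | falsum => True
  | eq _ _ => True
  | le _ _ => True
  | and φ ψ => noBox φ ∧ noBox ψ
  | or φ ψ => noBox φ ∧ noBox ψ
  | imp φ ψ => noBox φ ∧ noBox ψ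
  | neg φ => noBox φ
  | all _ φ => noBox φ
  | ex _ φ => noBox φ
  | box _ => False

/-- Truth in the standard model ℕ under a valuation (meaningful for L_A-formulas;
boxed formulas are given the dummy value `False`). -/
def val : Formula → (ℕ → ℕ) → Prop
  | falsum, _ => False
  | eq t u, v => t.val v = u.val v
  | le t u, v => t.val v ≤ u.val v
  | and φ ψ, v => val φ v ∧ val ψ v
  | or φ ψ, v => val φ v ∨ val ψ v
  | imp φ ψ, v => val φ v → val ψ v
  | neg φ, v => ¬ val φ v
  | all x φ, v => ∀ n : ℕ, val φ (Function.update v x n)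
  | ex x φ, v => ∃ n : ℕ, val φ (Function.update v x n)
  | box _, _ => False

/-- Biconditional, as an abbreviation. -/
def iff (φ ψ : Formula) : Formula := (φ.imp ψ).and (ψ.imp φ)

/-- `t < u` abbreviates `S t ≤ u`. -/
def lt (t u : Term) : Formula := le (Term.succ t) u

/-- Bounded universal quantification `∀ x < t, φ`. -/
def ball (x : ℕ) (t : Term) (φ : Formula) : Formula :=
  all x ((lt (Term.var x) t).imp φ)

/-- Bounded existential quantification `∃ x < t, φ`. -/
def bex (x : ℕ) (t : Term) (φ : Formula) : Formula :=
  ex x ((lt (Term.var x) t).and φ)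

/-- A Gödel numbering of formulas. -/
def code : Formula → ℕ
  | falsum => Nat.pair 0 0
  | eq t u => Nat.pair 1 (Nat.pair t.code u.code)
  | le t u => Nat.pair 2 (Nat.pair t.code u.code)
  | and φ ψ => Nat.pair 3 (Nat.pair (code φ) (code ψ))
  | or φ ψ => Nat.pair 4 (Nat.pair (code φ) (code ψ))
  | imp φ ψ => Nat.pair 5 (Nat.pair (code φ) (code ψ))
  | neg φ => Nat.pair 6 (code φ)
  | all x φ => Nat.pair 7 (Nat.pair x (code φ))
  | ex x φ => Nat.pair 8 (Nat.pair x (code φ))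
  | box φ => Nat.pair 9 (code φ)

end Formula

/-- A sentence is a formula with no free variables. -/
def Sentence (φ : Formula) : Prop := φ.fv = ∅

/-- Truth in the standard model ℕ (for sentences; any fixed valuation will do). -/
def StdTrue (φ : Formula) : Prop := φ.val fun _ => 0

/-- The logical axioms of classical first-order logic with equality for L_□,
with the identity axioms only for atomic formulas. -/
inductive LogicalAxiom : Formula → Prop
  | imp1 (φ ψ : Formula) : LogicalAxiom (φ.imp (ψ.imp φ))
  | imp2 (φ ψ χ : Formula) :
      LogicalAxiom ((φ.imp (ψ.imp χ)).imp ((φ.imp ψ).imp (φ.imp χ)))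
  | dne (φ : Formula) : LogicalAxiom (φ.neg.neg.imp φ)
  | negI (φ ψ : Formula) : LogicalAxiom ((φ.imp ψ).imp ((φ.imp ψ.neg).imp φ.neg))
  | negE (φ ψ : Formula) : LogicalAxiom (φ.neg.imp (φ.imp ψ))
  | falsumE (φ : Formula) : LogicalAxiom (Formula.falsum.imp φ)
  | negIntro (φ : Formula) : LogicalAxiom ((φ.imp Formula.falsum).imp φ.neg)
  | negElimFalsum (φ : Formula) : LogicalAxiom (φ.neg.imp (φ.imp Formula.falsum))
  | andI (φ ψ : Formula) : LogicalAxiom (φ.imp (ψ.imp (φ.and ψ)))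
  | andE1 (φ ψ : Formula) : LogicalAxiom ((φ.and ψ).imp φ)
  | andE2 (φ ψ : Formula) : LogicalAxiom ((φ.and ψ).imp ψ)
  | orI1 (φ ψ : Formula) : LogicalAxiom (φ.imp (φ.or ψ))
  | orI2 (φ ψ : Formula) : LogicalAxiom (ψ.imp (φ.or ψ))
  | orE (φ ψ χ : Formula) :
      LogicalAxiom ((φ.imp χ).imp ((ψ.imp χ).imp ((φ.or ψ).imp χ)))
  | allE (x : ℕ) (t : Term) (φ : Formula) :
      φ.freeFor t x → LogicalAxiom ((Formula.all x φ).imp (φ.subst x t))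
  | allImp (x : ℕ) (φ ψ : Formula) :
      x ∉ φ.fv → LogicalAxiom ((Formula.all x (φ.imp ψ)).imp (φ.imp (Formula.all x ψ)))
  | exI (x : ℕ) (t : Term) (φ : Formula) :
      φ.freeFor t x → LogicalAxiom ((φ.subst x t).imp (Formula.ex x φ))
  | exE (x : ℕ) (φ ψ : Formula) :
      x ∉ ψ.fv → LogicalAxiom ((Formula.all x (φ.imp ψ)).imp ((Formula.ex x φ).imp ψ))
  | eqRefl (t : Term) : LogicalAxiom (Formula.eq t t)
  | eqSymm (t u : Term) : LogicalAxiom ((Formula.eq t u).imp (Formula.eq u t))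
  | eqTrans (t u w : Term) :
      LogicalAxiom ((Formula.eq t u).imp ((Formula.eq u w).imp (Formula.eq t w)))
  | eqSucc (t u : Term) :
      LogicalAxiom ((Formula.eq t u).imp (Formula.eq t.succ u.succ))
  | eqAdd (t₁ t₂ u₁ u₂ : Term) :
      LogicalAxiom ((Formula.eq t₁ t₂).imp ((Formula.eq u₁ u₂).imp
        (Formula.eq (t₁.add u₁) (t₂.add u₂))))
  | eqMul (t₁ t₂ u₁ u₂ : Term) :
      LogicalAxiom ((Formula.eq t₁ t₂).imp ((Formula.eq u₁ u₂).imp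
        (Formula.eq (t₁.mul u₁) (t₂.mul u₂))))
  | eqLe (t₁ t₂ u₁ u₂ : Term) :
      LogicalAxiom ((Formula.eq t₁ t₂).imp ((Formula.eq u₁ u₂).imp
        ((Formula.le t₁ u₁).imp (Formula.le t₂ u₂))))

/-- Provability in an L_□-theory: logical axioms, the axioms of the theory, and the
rules modus ponens, generalization, and necessitation. -/
inductive Provable (T : Set Formula) : Formula → Prop
  | ax {φ : Formula} : φ ∈ T → Provable T φ
  | logic {φ : Formula} : LogicalAxiom φ → Provable T φ
  | mp {φ ψ : Formula} : Provable T (φ.imp ψ) → Provable T φ → Provable T ψ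
  | gen {φ : Formula} (x : ℕ) : Provable T φ → Provable T (Formula.all x φ)
  | nec {φ : Formula} : Provable T φ → Provable T (Formula.box φ)

/-- First-order provability (no necessitation rule); used for the non-modal theory PA. -/
inductive FOProvable (T : Set Formula) : Formula → Prop
  | ax {φ : Formula} : φ ∈ T → FOProvable T φ
  | logic {φ : Formula} : LogicalAxiom φ → FOProvable T φ
  | mp {φ ψ : Formula} : FOProvable T (φ.imp ψ) → FOProvable T φ → FOProvable T ψ
  | gen {φ : Formula} (x : ℕ) : FOProvable T φ → FOProvable T (Formula.all x φ)

/-- Basic (Robinson-style) axioms of arithmetic. -/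
def succNeZero : Formula := (Formula.eq (Term.succ (Term.var 0)) Term.zero).neg
def succInj : Formula :=
  (Formula.eq (Term.succ (Term.var 0)) (Term.succ (Term.var 1))).imp
    (Formula.eq (Term.var 0) (Term.var 1))
def addZero : Formula := Formula.eq (Term.add (Term.var 0) Term.zero) (Term.var 0)
def addSucc : Formula :=
  Formula.eq (Term.add (Term.var 0) (Term.succ (Term.var 1)))
    (Term.succ (Term.add (Term.var 0) (Term.var 1)))
def mulZero : Formula := Formula.eq (Term.mul (Term.var 0) Term.zero) Term.zero
def mulSucc : Formula :=
  Formula.eq (Term.mul (Term.var 0) (Term.succ (Term.var 1)))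
    (Term.add (Term.mul (Term.var 0) (Term.var 1)) (Term.var 0))
def leDef : Formula :=
  (Formula.le (Term.var 0) (Term.var 1)).iff
    (Formula.ex 2 (Formula.eq (Term.add (Term.var 0) (Term.var 2)) (Term.var 1)))

def baseAxioms : Set Formula :=
  {succNeZero, succInj, addZero, addSucc, mulZero, mulSucc, leDef}

/-- The induction axiom for the formula `φ` and the variable `x`. -/
def inductionAx (x : ℕ) (φ : Formula) : Formula :=
  ((φ.subst x Term.zero).and
    (Formula.all x (φ.imp (φ.subst x (Term.succ (Term.var x)))))).imp
      (Formula.all x φ)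

/-- Peano arithmetic PA: basic axioms plus induction for L_A-formulas. -/
def PA : Set Formula :=
  baseAxioms ∪ {χ | ∃ (x : ℕ) (φ : Formula), φ.noBox ∧ χ = inductionAx x φ}

/-- PA_□ : basic axioms plus induction for all L_□-formulas. -/
def PABox : Set Formula :=
  baseAxioms ∪ {χ | ∃ (x : ℕ) (φ : Formula), χ = inductionAx x φ}

/-- The distribution axiom K. -/
def axK (φ ψ : Formula) : Formula :=
  (Formula.box (φ.imp ψ)).imp ((Formula.box φ).imp (Formula.box ψ))

/-- PA(K). -/
def PAK : Set Formula := PABox ∪ {χ | ∃ φ ψ : Formula, χ = axK φ ψ}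

/-- The axiom 4. -/
def ax4 (φ : Formula) : Formula := (Formula.box φ).imp (Formula.box (Formula.box φ))

/-- PA(K4). -/
def PAK4 : Set Formula := PAK ∪ {χ | ∃ φ : Formula, χ = ax4 φ}

/-- The axiom of Triv. -/
def axTriv (φ : Formula) : Formula := (Formula.box φ).iff φ

/-- PA(Triv). -/
def PATriv : Set Formula := PAK ∪ {χ | ∃ φ : Formula, χ = axTriv φ}

/-- PA(Ver). -/
def PAVer : Set Formula := PAK ∪ {Formula.box Formula.falsum}

/-- `T` extends `U`: every axiom of `U` is provable in `T`. -/
def Extends (T U : Set Formula) : Prop := ∀ φ ∈ U, Provable T φ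

/-- Consistency. -/
def Consistent (T : Set Formula) : Prop := ¬ Provable T Formula.falsum

/-- The class Δ₀ of bounded L_A-formulas. -/
inductive IsDelta0 : Formula → Prop
  | falsum : IsDelta0 Formula.falsum
  | eq (t u : Term) : IsDelta0 (Formula.eq t u)
  | le (t u : Term) : IsDelta0 (Formula.le t u)
  | and {φ ψ : Formula} : IsDelta0 φ → IsDelta0 ψ → IsDelta0 (φ.and ψ)
  | or {φ ψ : Formula} : IsDelta0 φ → IsDelta0 ψ → IsDelta0 (φ.or ψ)
  | imp {φ ψ : Formula} : IsDelta0 φ → IsDelta0 ψ → IsDelta0 (φ.imp ψ)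
  | neg {φ : Formula} : IsDelta0 φ → IsDelta0 φ.neg
  | ball {x : ℕ} {t : Term} {φ : Formula} :
      x ∉ t.fv → IsDelta0 φ → IsDelta0 (Formula.ball x t φ)
  | bex {x : ℕ} {t : Term} {φ : Formula} :
      x ∉ t.fv → IsDelta0 φ → IsDelta0 (Formula.bex x t φ)

/-- The class Σ₁ of L_A-formulas. -/
inductive IsSigma1 : Formula → Prop
  | delta0 {φ : Formula} : IsDelta0 φ → IsSigma1 φ
  | and {φ ψ : Formula} : IsSigma1 φ → IsSigma1 ψ → IsSigma1 (φ.and ψ)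
  | or {φ ψ : Formula} : IsSigma1 φ → IsSigma1 ψ → IsSigma1 (φ.or ψ)
  | ex {x : ℕ} {φ : Formula} : IsSigma1 φ → IsSigma1 (Formula.ex x φ)
  | ball {x : ℕ} {t : Term} {φ : Formula} :
      x ∉ t.fv → IsSigma1 φ → IsSigma1 (Formula.ball x t φ)

/-- The class B of boxed formulas. -/
def IsB (φ : Formula) : Prop := ∃ ψ : Formula, φ = Formula.box ψ

/-- The class ΔB. -/
inductive IsDeltaB : Formula → Prop
  | delta0 {φ : Formula} : IsDelta0 φ → IsDeltaB φ
  | b (ψ : Formula) : IsDeltaB (Formula.box ψ)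
  | and {φ ψ : Formula} : IsDeltaB φ → IsDeltaB ψ → IsDeltaB (φ.and ψ)
  | or {φ ψ : Formula} : IsDeltaB φ → IsDeltaB ψ → IsDeltaB (φ.or ψ)
  | ball {x : ℕ} {t : Term} {φ : Formula} :
      x ∉ t.fv → IsDeltaB φ → IsDeltaB (Formula.ball x t φ)
  | bex {x : ℕ} {t : Term} {φ : Formula} :
      x ∉ t.fv → IsDeltaB φ → IsDeltaB (Formula.bex x t φ)

/-- The class ΣB. -/
inductive IsSigmaB : Formula → Prop
  | sigma1 {φ : Formula} : IsSigma1 φ → IsSigmaB φ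
  | b (ψ : Formula) : IsSigmaB (Formula.box ψ)
  | and {φ ψ : Formula} : IsSigmaB φ → IsSigmaB ψ → IsSigmaB (φ.and ψ)
  | or {φ ψ : Formula} : IsSigmaB φ → IsSigmaB ψ → IsSigmaB (φ.or ψ)
  | ex {x : ℕ} {φ : Formula} : IsSigmaB φ → IsSigmaB (Formula.ex x φ)
  | ball {x : ℕ} {t : Term} {φ : Formula} :
      x ∉ t.fv → IsSigmaB φ → IsSigmaB (Formula.ball x t φ)

/-- Iterated disjunction (the empty disjunction is ⊥). -/
def disj : List Formula → Formula
  | [] => Formula.falsum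
  | [φ] => φ
  | φ :: ψ :: l => φ.or (disj (ψ :: l))

/-- Iterated conjunction (the empty conjunction is ⊤). -/
def conj : List Formula → Formula
  | [] => Formula.falsum.neg
  | [φ] => φ
  | φ :: ψ :: l => φ.and (conj (ψ :: l))

/-- Γ-disjunction property. -/
def HasDP (T : Set Formula) (Γ : Formula → Prop) : Prop :=
  ∀ φ ψ : Formula, Γ φ → Γ ψ → Sentence φ → Sentence ψ →
    Provable T (φ.or ψ) → Provable T φ ∨ Provable T ψ

/-- (Γ, Θ)-disjunction property. -/
def HasDP2 (T : Set Formula) (Γ Θ : Formula → Prop) : Prop :=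
  ∀ φ ψ : Formula, Γ φ → Θ ψ → Sentence φ → Sentence ψ →
    Provable T (φ.or ψ) → Provable T φ ∨ Provable T ψ

/-- Γ-existence property. -/
def HasEP (T : Set Formula) (Γ : Formula → Prop) : Prop :=
  ∀ (x : ℕ) (φ : Formula), Γ φ → φ.fv ⊆ {x} →
    Provable T (Formula.ex x φ) → ∃ n : ℕ, Provable T (φ.subst x (Term.numeral n))

/-- Modal disjunction property. -/
def HasMDP (T : Set Formula) : Prop :=
  ∀ φ ψ : Formula, Sentence φ → Sentence ψ →
    Provable T ((Formula.box φ).or (Formula.box ψ)) → Provable T φ ∨ Provable T ψ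

/-- Modal existence property. -/
def HasMEP (T : Set Formula) : Prop :=
  ∀ (x : ℕ) (φ : Formula), φ.fv ⊆ {x} →
    Provable T (Formula.ex x (Formula.box φ)) →
      ∃ n : ℕ, Provable T (φ.subst x (Term.numeral n))

/-- n-fold B-disjunction property. -/
def HasBnDP (T : Set Formula) (n : ℕ) : Prop :=
  ∀ φ : Fin n → Formula, (∀ i, Sentence (φ i)) →
    Provable T (disj (List.ofFn fun i => Formula.box (φ i))) →
    ∃ i, Provable T (Formula.box (φ i))

/-- Σ₁-soundness. -/
def Sigma1Sound (T : Set Formula) : Prop :=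
  ∀ φ : Formula, IsSigma1 φ → Sentence φ → Provable T φ → StdTrue φ

/-- L_A-soundness. -/
def LASound (T : Set Formula) : Prop :=
  ∀ φ : Formula, φ.noBox → Sentence φ → Provable T φ → StdTrue φ

/-- `T` is recursively enumerable (via the Gödel numbering of formulas). -/
def RE (T : Set Formula) : Prop :=
  Nat.Partrec fun n => Part.assert (∃ φ ∈ T, Formula.code φ = n) fun _ => Part.some 0

/-- A fixed natural Σ₁ provability predicate `Pr_T(x)` for the theory `T`:
a Σ₁ L_A-formula with only the free variable `0` which numerates provability in `T`
in the standard model and satisfies the standard derivability conditions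
(provably in PA). -/
structure ProvPred (T : Set Formula) where
  pr : Formula
  noBox : pr.noBox
  sigma1 : IsSigma1 pr
  fvSub : pr.fv ⊆ {0}
  numerates : ∀ φ : Formula,
    StdTrue (pr.subst 0 (Term.numeral φ.code)) ↔ Provable T φ
  d1 : ∀ φ : Formula, Provable T φ → FOProvable PA (pr.subst 0 (Term.numeral φ.code))
  d2 : ∀ φ ψ : Formula,
    FOProvable PA ((pr.subst 0 (Term.numeral (φ.imp ψ).code)).imp
      ((pr.subst 0 (Term.numeral φ.code)).imp (pr.subst 0 (Term.numeral ψ.code))))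
  necClosed : ∀ φ : Formula,
    FOProvable PA ((pr.subst 0 (Term.numeral φ.code)).imp
      (pr.subst 0 (Term.numeral (Formula.box φ).code)))

/-- `Pr_T(⌜φ⌝)`. -/
def ProvPred.app {T : Set Formula} (P : ProvPred T) (φ : Formula) : Formula :=
  P.pr.subst 0 (Term.numeral φ.code)

/-- Γ-disjunctive correctness (Γ-DC). -/
def DC (T : Set Formula) (P : ProvPred T) (Γ : Formula → Prop) : Prop :=
  ∀ φ : Formula, Γ φ → Sentence φ → Provable T (φ.or (P.app φ)) → Provable T φ

/-- The substitution replacing each variable by the numeral of its value. -/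
def numeralSubst (v : ℕ → ℕ) : ℕ → Term := fun x => Term.numeral (v x)

/-- Standard-model satisfaction of the ρ_T-translation: `ρ_T` is the identity on
L_A-formulas, commutes with connectives and quantifiers, and sends `□φ(x⃗)` to
`Pr_T(⌜□φ(ẋ⃗)⌝)`, whose truth in ℕ (for a natural provability predicate) amounts to
provability in `T` of `□φ(n̄⃗)`. -/
def RhoSat (T : Set Formula) : Formula → (ℕ → ℕ) → Prop
  | .falsum, _ => False
  | .eq t u, v => t.val v = u.val v
  | .le t u, v => t.val v ≤ u.val v
  | .and φ ψ, v => RhoSat T φ v ∧ RhoSat T ψ v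
  | .or φ ψ, v => RhoSat T φ v ∨ RhoSat T ψ v
  | .imp φ ψ, v => RhoSat T φ v → RhoSat T ψ v
  | .neg φ, v => ¬ RhoSat T φ v
  | .all x φ, v => ∀ n : ℕ, RhoSat T φ (Function.update v x n)
  | .ex x φ, v => ∃ n : ℕ, RhoSat T φ (Function.update v x n)
  | .box φ, v => Provable T (Formula.box (φ.substAll (numeralSubst v)))

/-- Standard-model satisfaction of the π_T-translation: `π_T` is the identity on
L_A-formulas, commutes with connectives and quantifiers, and sends `□φ(x⃗)` to
`Pr_T(⌜φ(ẋ⃗)⌝)`, whose truth in ℕ (for a natural provability predicate) amounts to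
provability in `T` of `φ(n̄⃗)`. -/
def PiSat (T : Set Formula) : Formula → (ℕ → ℕ) → Prop
  | .falsum, _ => False
  | .eq t u, v => t.val v = u.val v
  | .le t u, v => t.val v ≤ u.val v
  | .and φ ψ, v => PiSat T φ v ∧ PiSat T ψ v
  | .or φ ψ, v => PiSat T φ v ∨ PiSat T ψ v
  | .imp φ ψ, v => PiSat T φ v → PiSat T ψ v
  | .neg φ, v => ¬ PiSat T φ v
  | .all x φ, v => ∀ n : ℕ, PiSat T φ (Function.update v x n)
  | .ex x φ, v => ∃ n : ℕ, PiSat T φ (Function.update v x n)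
  | .box φ, v => Provable T (φ.substAll (numeralSubst v))

/-- Weak ΣB-soundness: every provable ΣB sentence is true in ℕ under ρ_T. -/
def WeaklySigmaBSound (T : Set Formula) : Prop :=
  ∀ φ : Formula, IsSigmaB φ → Sentence φ → Provable T φ → RhoSat T φ fun _ => 0

/-- ΣB-soundness: every provable ΣB sentence is true in ℕ under π_T. -/
def SigmaBSound (T : Set Formula) : Prop :=
  ∀ φ : Formula, IsSigmaB φ → Sentence φ → Provable T φ → PiSat T φ fun _ => 0

end ModalArith

namespace ModalArith

namespace Term

theorem substAll_congr (t : Term) (v w : ℕ → Term) (h : ∀ y ∈ t.fv, v y = w y) :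
    t.substAll v = t.substAll w := by
  induction t with
  | var x => exact h x (by simp [fv])
  | zero => rfl
  | succ t ih => simp only [substAll]; rw [ih h]
  | add t u ih1 ih2 =>
    simp only [substAll]
    rw [ih1 fun y hy => h y (by simp [fv, hy]), ih2 fun y hy => h y (by simp [fv, hy])]
  | mul t u ih1 ih2 =>
    simp only [substAll]
    rw [ih1 fun y hy => h y (by simp [fv, hy]), ih2 fun y hy => h y (by simp [fv, hy])]

theorem substAll_var (t : Term) : t.substAll var = t := by
  induction t <;> simp_all [substAll]

theorem substAll_closed (t : Term) (h : t.fv = ∅) (v : ℕ → Term) : t.substAll v = t := by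
  rw [substAll_congr t v var (by simp [h]), substAll_var]

theorem numeral_fv (n : ℕ) : (numeral n).fv = ∅ := by
  induction n <;> simp_all [numeral, fv]

theorem numeral_substAll (n : ℕ) (v : ℕ → Term) : (numeral n).substAll v = numeral n :=
  substAll_closed _ (numeral_fv n) v

theorem substAll_comp (t : Term) (v w : ℕ → Term) :
    (t.substAll v).substAll w = t.substAll (fun y => (v y).substAll w) := by
  induction t <;> simp_all [substAll]

theorem fv_numeralSubst (t : Term) (v : ℕ → ℕ) : (t.substAll (numeralSubst v)).fv = ∅ := by
  induction t <;> simp_all [substAll, fv, numeralSubst, numeral_fv]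

/-- Iterated successor. -/
def iterS : ℕ → Term → Term
  | 0, s => s
  | n + 1, s => succ (iterS n s)

theorem iterS_succ (n : ℕ) (s : Term) : iterS n (succ s) = succ (iterS n s) := by
  induction n <;> simp_all [iterS]

theorem iterS_substAll (n : ℕ) (s : Term) (v : ℕ → Term) :
    (iterS n s).substAll v = iterS n (s.substAll v) := by
  induction n <;> simp_all [iterS, substAll]

theorem iterS_fv (n : ℕ) (s : Term) : (iterS n s).fv = s.fv := by
  induction n <;> simp_all [iterS, fv]

theorem iterS_numeral (n k : ℕ) : iterS n (numeral k) = numeral (k + n) := by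
  induction n with
  | zero => rfl
  | succ n ih => simp [iterS, ih, numeral]

end Term

namespace Formula

theorem substAll_comp (φ : Formula) (v w : ℕ → Term) (h : ∀ y, (v y).fv ⊆ {y}) :
    (φ.substAll v).substAll w = φ.substAll (fun y => (v y).substAll w) := by
  have key : ∀ (x : ℕ) (v w : ℕ → Term), (∀ y, (v y).fv ⊆ {y}) →
      (∀ y, (Function.update v x (Term.var x) y).fv ⊆ {y}) ∧
      (fun y => (Function.update v x (Term.var x) y).substAll
          (Function.update w x (Term.var x))) =
        Function.update (fun y => (v y).substAll w) x (Term.var x) := by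
    intro x v w h
    constructor
    · intro y
      by_cases hy : y = x
      · subst hy; simp [Term.fv]
      · simpa [Function.update_of_ne hy] using h y
    · funext y
      by_cases hy : y = x
      · subst hy; simp [Term.substAll]
      · simp only [Function.update_of_ne hy]
        apply Term.substAll_congr
        intro z hz
        have := h y hz
        simp only [Finset.mem_singleton] at this
        rw [this, Function.update_of_ne hy]
  induction φ generalizing v w with
  | falsum => rfl
  | eq t u => simp [substAll, Term.substAll_comp]
  | le t u => simp [substAll, Term.substAll_comp]
  | and φ ψ ih1 ih2 => simp only [substAll]; rw [ih1 v w h, ih2 v w h]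
  | or φ ψ ih1 ih2 => simp only [substAll]; rw [ih1 v w h, ih2 v w h]
  | imp φ ψ ih1 ih2 => simp only [substAll]; rw [ih1 v w h, ih2 v w h]
  | neg φ ih => simp only [substAll]; rw [ih v w h]
  | box φ ih => simp only [substAll]; rw [ih v w h]
  | all x φ ih =>
    simp only [substAll]
    rw [ih _ _ (key x v w h).1, (key x v w h).2]
  | ex x φ ih =>
    simp only [substAll]
    rw [ih _ _ (key x v w h).1, (key x v w h).2]

theorem substAll_eq_self (φ : Formula) (v : ℕ → Term) (h : ∀ y ∈ φ.fv, v y = Term.var y) :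
    φ.substAll v = φ := by
  have ht : ∀ (t : Term) (v : ℕ → Term), (∀ y ∈ t.fv, v y = Term.var y) →
      t.substAll v = t := fun t v h => by
    rw [Term.substAll_congr t v Term.var h, Term.substAll_var]
  have key : ∀ (x : ℕ) (s : Finset ℕ) (v : ℕ → Term),
      (∀ y ∈ s.erase x, v y = Term.var y) →
      ∀ y ∈ s, Function.update v x (Term.var x) y = Term.var y := by
    intro x s v h y hy
    by_cases hyx : y = x
    · subst hyx; simp
    · rw [Function.update_of_ne hyx]; exact h y (by simp [hyx, hy])
  induction φ generalizing v with
  | falsum => rfl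
  | eq t u =>
    simp only [substAll]
    rw [ht t v fun y hy => h y (by simp [fv, hy]), ht u v fun y hy => h y (by simp [fv, hy])]
  | le t u =>
    simp only [substAll]
    rw [ht t v fun y hy => h y (by simp [fv, hy]), ht u v fun y hy => h y (by simp [fv, hy])]
  | and φ ψ ih1 ih2 =>
    simp only [substAll]
    rw [ih1 v fun y hy => h y (by simp [fv, hy]), ih2 v fun y hy => h y (by simp [fv, hy])]
  | or φ ψ ih1 ih2 =>
    simp only [substAll]
    rw [ih1 v fun y hy => h y (by simp [fv, hy]), ih2 v fun y hy => h y (by simp [fv, hy])]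
  | imp φ ψ ih1 ih2 =>
    simp only [substAll]
    rw [ih1 v fun y hy => h y (by simp [fv, hy]), ih2 v fun y hy => h y (by simp [fv, hy])]
  | neg φ ih => simp only [substAll]; rw [ih v h]
  | box φ ih => simp only [substAll]; rw [ih v h]
  | all x φ ih => simp only [substAll]; rw [ih _ (key x _ v h)]
  | ex x φ ih => simp only [substAll]; rw [ih _ (key x _ v h)]

theorem freeFor_of_subset (s : Term) (x : ℕ) (h : s.fv ⊆ {x}) (φ : Formula) :
    φ.freeFor s x := by
  have key : ∀ y : ℕ, x = y ∨ y ∉ s.fv := fun y => by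
    by_cases hy : x = y
    · exact Or.inl hy
    · exact Or.inr fun hm => hy (by simpa using (Finset.mem_singleton.1 (h hm)).symm)
  induction φ with
  | falsum => trivial
  | eq t u => trivial
  | le t u => trivial
  | and φ ψ ih1 ih2 => exact ⟨ih1, ih2⟩
  | or φ ψ ih1 ih2 => exact ⟨ih1, ih2⟩
  | imp φ ψ ih1 ih2 => exact ⟨ih1, ih2⟩
  | neg φ ih => exact ih
  | box φ ih => exact ih
  | all y φ ih =>
    rcases key y with h | h
    · exact Or.inl h
    · exact Or.inr (Or.inr ⟨h, ih⟩)
  | ex y φ ih =>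
    rcases key y with h | h
    · exact Or.inl h
    · exact Or.inr (Or.inr ⟨h, ih⟩)

theorem subst_subst (φ : Formula) (x : ℕ) (s t : Term) (h : s.fv ⊆ {x}) :
    (φ.subst x s).subst x t = φ.subst x (Term.subst x t s) := by
  unfold subst
  rw [substAll_comp]
  · congr 1
    funext y
    by_cases hy : y = x
    · subst hy; simp [Term.subst]
    · simp [Function.update_of_ne hy, Term.substAll]
  · intro y
    by_cases hy : y = x
    · subst hy; simpa using h
    · simp [Function.update_of_ne hy, Term.fv]

theorem subst_self (φ : Formula) (x : ℕ) : φ.subst x (Term.var x) = φ := by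
  apply substAll_eq_self
  simp

/-- Instantiating the bound variable of a numeral substitution. -/
theorem subst_numeralSubst (φ : Formula) (v : ℕ → ℕ) (x n : ℕ) :
    (φ.substAll (Function.update (numeralSubst v) x (Term.var x))).subst x (Term.numeral n) =
      φ.substAll (numeralSubst (Function.update v x n)) := by
  unfold subst
  rw [substAll_comp]
  · congr 1
    funext y
    by_cases hy : y = x
    · subst hy; simp [Term.substAll, numeralSubst]
    · simp [Function.update_of_ne hy, numeralSubst, Term.numeral_substAll]
  · intro y
    by_cases hy : y = x
    · subst hy; simp [Term.fv]
    · simp [Function.update_of_ne hy, numeralSubst, Term.numeral_fv]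

end Formula

open Formula

variable {T : Set Formula}

namespace Provable

theorem imp_intro {A B : Formula} (h : Provable T B) : Provable T (A.imp B) :=
  .mp (.logic (.imp1 _ _)) h

theorem imp_mp {A B C : Formula} (h1 : Provable T (A.imp (B.imp C)))
    (h2 : Provable T (A.imp B)) : Provable T (A.imp C) :=
  .mp (.mp (.logic (.imp2 _ _ _)) h1) h2

theorem imp_trans {A B C : Formula} (h1 : Provable T (A.imp B))
    (h2 : Provable T (B.imp C)) : Provable T (A.imp C) :=
  imp_mp (imp_intro h2) h1

theorem imp_self (A : Formula) : Provable T (A.imp A) :=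
  imp_mp (.logic (.imp1 A (A.imp A))) (.logic (.imp1 A A))

theorem neg_falsum {A : Formula} (h : Provable T A.neg) : Provable T (A.imp falsum) :=
  .mp (.logic (.negElimFalsum _)) h

theorem neg_intro {A : Formula} (h : Provable T (A.imp falsum)) : Provable T A.neg :=
  .mp (.logic (.negIntro _)) h

theorem contra {A B : Formula} (h : Provable T (A.imp B)) (hB : Provable T B.neg) :
    Provable T A.neg :=
  neg_intro (imp_trans h (neg_falsum hB))

theorem absurd_imp {A B : Formula} (h : Provable T A.neg) : Provable T (A.imp B) :=
  .mp (.logic (.negE _ _)) h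

theorem inst {A : Formula} (x : ℕ) (t : Term) (hf : A.freeFor t x) (h : Provable T A) :
    Provable T (A.subst x t) :=
  .mp (.logic (.allE x t A hf)) (.gen x h)

theorem eq_trans {a b c : Term} (h1 : Provable T (eq a b)) (h2 : Provable T (eq b c)) :
    Provable T (eq a c) :=
  .mp (.mp (.logic (.eqTrans _ _ _)) h1) h2

theorem eq_symm {a b : Term} (h1 : Provable T (eq a b)) : Provable T (eq b a) :=
  .mp (.logic (.eqSymm _ _)) h1

/-- Replace both sides inside an implication of equations. -/
theorem eq_imp {a b c d : Term} (h1 : Provable T (eq c a)) (h2 : Provable T (eq b d)) :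
    Provable T ((eq a b).imp (eq c d)) := by
  have e1 : Provable T ((eq a b).imp (eq c b)) := .mp (.logic (.eqTrans _ _ _)) h1
  have e2 : Provable T ((eq c b).imp (eq c d)) :=
    imp_mp (.logic (.eqTrans _ _ _)) (imp_intro h2)
  exact imp_trans e1 e2

end Provable

open Provable

theorem ext_base (hT : Extends T PAVer) {A : Formula} (h : A ∈ baseAxioms) : Provable T A :=
  hT A (Or.inl (Or.inl (Or.inl h)))

theorem ext_PA (hT : Extends T PAVer) {A : Formula} (h : FOProvable PA A) : Provable T A := by
  induction h with
  | ax h =>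
    rcases h with h | ⟨x, φ, _, rfl⟩
    · exact ext_base hT h
    · exact hT _ (Or.inl (Or.inl (Or.inr ⟨x, φ, rfl⟩)))
  | logic h => exact .logic h
  | mp _ _ h1 h2 => exact .mp h1 h2
  | gen x _ h => exact .gen x h

theorem box_provable (hT : Extends T PAVer) (A : Formula) : Provable T (box A) := by
  have h1 : Provable T (box falsum) := hT _ (Or.inr rfl)
  have h2 : Provable T (axK falsum A) := hT _ (Or.inl (Or.inr ⟨_, _, rfl⟩))
  exact .mp (.mp h2 (.nec (.logic (.falsumE A)))) h1

/-- Case distinction zero / successor. -/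
theorem cases_one (hT : Extends T PAVer) (x : ℕ) (θ : Formula)
    (h0 : Provable T (θ.subst x Term.zero))
    (h1 : Provable T (θ.subst x (Term.succ (Term.var x)))) : Provable T θ := by
  have hi : Provable T (inductionAx x θ) := hT _ (Or.inl (Or.inl (Or.inr ⟨x, θ, rfl⟩)))
  have ha : Provable T (all x θ) :=
    .mp hi (.mp (.mp (.logic (.andI _ _)) h0) (.gen x (imp_intro h1)))
  have := Provable.mp (.logic (.allE x (Term.var x) θ
    (freeFor_of_subset _ _ (by simp [Term.fv]) θ))) ha
  rwa [subst_self] at this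

theorem cases_many (hT : Extends T PAVer) (x : ℕ) (n : ℕ) (θ : Formula)
    (h0 : ∀ k < n, Provable T (θ.subst x (Term.numeral k)))
    (h1 : Provable T (θ.subst x (Term.iterS n (Term.var x)))) : Provable T θ := by
  induction n generalizing θ with
  | zero => rwa [Term.iterS, subst_self] at h1
  | succ n ih =>
    refine cases_one hT x θ (h0 0 (Nat.succ_pos n)) (ih _ ?_ ?_)
    · intro k hk
      rw [subst_subst _ _ _ _ (by simp [Term.fv])]
      simpa [Term.subst, Term.substAll, Term.numeral] using h0 (k + 1) (by omega)
    · rw [subst_subst _ _ _ _ (by simp [Term.fv])]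
      simpa [Term.subst, Term.substAll, Term.iterS] using h1

theorem p_succNeZero (hT : Extends T PAVer) (t : Term) :
    Provable T (eq t.succ Term.zero).neg := by
  have h := (ext_base hT (A := succNeZero) (by simp [baseAxioms])).inst 0 t (by trivial)
  simpa [succNeZero, Formula.subst, Formula.substAll, Term.substAll] using h

/-- Instantiate two variables by a numeral and a term. -/
theorem inst01 {A : Formula} (t : Term) (n : ℕ) (hf : A.freeFor (Term.numeral n) 1)
    (hg : (A.subst 1 (Term.numeral n)).freeFor t 0) (h : Provable T A) :
    Provable T ((A.subst 1 (Term.numeral n)).subst 0 t) :=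
  (h.inst 1 _ hf).inst 0 t hg

theorem p_succInj (hT : Extends T PAVer) (t : Term) (n : ℕ) :
    Provable T ((eq t.succ (Term.numeral n).succ).imp (eq t (Term.numeral n))) := by
  have h := inst01 t n (by exact ⟨trivial, trivial⟩) (by exact ⟨trivial, trivial⟩)
    (ext_base hT (A := succInj) (by simp [baseAxioms]))
  simpa [succInj, Formula.subst, Formula.substAll, Term.substAll,
    Term.numeral_substAll] using h

theorem p_addZero (hT : Extends T PAVer) (t : Term) :
    Provable T (eq (t.add Term.zero) t) := by
  have h := (ext_base hT (A := addZero) (by simp [baseAxioms])).inst 0 t (by trivial)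
  simpa [addZero, Formula.subst, Formula.substAll, Term.substAll] using h

theorem p_mulZero (hT : Extends T PAVer) (t : Term) :
    Provable T (eq (t.mul Term.zero) Term.zero) := by
  have h := (ext_base hT (A := mulZero) (by simp [baseAxioms])).inst 0 t (by trivial)
  simpa [mulZero, Formula.subst, Formula.substAll, Term.substAll] using h

theorem p_addSucc_num (hT : Extends T PAVer) (t : Term) (n : ℕ) :
    Provable T (eq (t.add (Term.numeral n).succ) (t.add (Term.numeral n)).succ) := by
  have h := inst01 t n (by trivial) (by trivial)
    (ext_base hT (A := addSucc) (by simp [baseAxioms]))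
  simpa [addSucc, Formula.subst, Formula.substAll, Term.substAll,
    Term.numeral_substAll] using h

theorem p_addSucc_var (hT : Extends T PAVer) (t : Term) :
    Provable T (eq (t.add (Term.var 1).succ) (t.add (Term.var 1)).succ) := by
  have h := (ext_base hT (A := addSucc) (by simp [baseAxioms])).inst 0 t (by trivial)
  simpa [addSucc, Formula.subst, Formula.substAll, Term.substAll] using h

theorem p_mulSucc_num (hT : Extends T PAVer) (t : Term) (n : ℕ) :
    Provable T (eq (t.mul (Term.numeral n).succ) ((t.mul (Term.numeral n)).add t)) := by
  have h := inst01 t n (by trivial) (by trivial)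
    (ext_base hT (A := mulSucc) (by simp [baseAxioms]))
  simpa [mulSucc, Formula.subst, Formula.substAll, Term.substAll,
    Term.numeral_substAll] using h

theorem p_le (hT : Extends T PAVer) (t : Term) (n : ℕ) (ht : 2 ∉ t.fv) :
    Provable T ((le t (Term.numeral n)).iff
      (ex 2 (eq (t.add (Term.var 2)) (Term.numeral n)))) := by
  have h := inst01 t n
    (by simp [leDef, Formula.iff, freeFor, Term.numeral_fv])
    (by simp [leDef, Formula.iff, freeFor, Formula.subst, Formula.substAll, ht])
    (ext_base hT (A := leDef) (by simp [baseAxioms]))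
  simpa [leDef, Formula.iff, Formula.subst, Formula.substAll, Term.substAll,
    Term.numeral_substAll] using h

theorem p_add (hT : Extends T PAVer) (m n : ℕ) :
    Provable T (eq ((Term.numeral m).add (Term.numeral n)) (Term.numeral (m + n))) := by
  induction n with
  | zero => exact p_addZero hT _
  | succ n ih =>
    exact (p_addSucc_num hT _ n).eq_trans (.mp (.logic (.eqSucc _ _)) ih)

theorem p_mul (hT : Extends T PAVer) (m n : ℕ) :
    Provable T (eq ((Term.numeral m).mul (Term.numeral n)) (Term.numeral (m * n))) := by
  induction n with
  | zero => exact p_mulZero hT _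
  | succ n ih =>
    exact (p_mulSucc_num hT _ n).eq_trans
      (.eq_trans (.mp (.mp (.logic (.eqAdd _ _ _ _)) ih) (.logic (.eqRefl _)))
        (p_add hT _ _))

theorem p_val (hT : Extends T PAVer) (t : Term) (v : ℕ → ℕ) :
    Provable T (eq (t.substAll (numeralSubst v)) (Term.numeral (t.val v))) := by
  induction t with
  | var x => exact .logic (.eqRefl _)
  | zero => exact .logic (.eqRefl _)
  | succ t ih => exact .mp (.logic (.eqSucc _ _)) ih
  | add t u ih1 ih2 =>
    exact .eq_trans (.mp (.mp (.logic (.eqAdd _ _ _ _)) ih1) ih2) (p_add hT _ _)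
  | mul t u ih1 ih2 =>
    exact .eq_trans (.mp (.mp (.logic (.eqMul _ _ _ _)) ih1) ih2) (p_mul hT _ _)

theorem p_iterS_ne (hT : Extends T PAVer) (n : ℕ) (s : Term) :
    Provable T (eq (Term.iterS (n + 1) s) (Term.numeral n)).neg := by
  induction n with
  | zero => exact p_succNeZero hT _
  | succ n ih => exact contra (p_succInj hT _ n) ih

theorem p_num_ne (hT : Extends T PAVer) (m n : ℕ) (h : m ≠ n) :
    Provable T (eq (Term.numeral m) (Term.numeral n)).neg := by
  have key : ∀ m n, n < m → Provable T (eq (Term.numeral m) (Term.numeral n)).neg := by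
    intro m n h
    have := p_iterS_ne hT n (Term.numeral (m - (n + 1)))
    rwa [Term.iterS_numeral, Nat.sub_add_cancel h] at this
  rcases Nat.lt_or_gt_of_ne h with h | h
  · exact contra (.logic (.eqSymm _ _)) (key n m h)
  · exact key m n h

theorem p_iterS_add_ne (hT : Extends T PAVer) (n : ℕ) (s : Term) (hs : 1 ∉ s.fv) :
    Provable T (eq ((Term.iterS (n + 1) s).add (Term.var 1)) (Term.numeral n)).neg := by
  have hsub : ∀ s : Term, 1 ∉ s.fv → ∀ u, s.substAll (Function.update Term.var 1 u) = s := by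
    intro s hs u
    rw [Term.substAll_congr _ _ Term.var, Term.substAll_var]
    intro y hy
    exact Function.update_of_ne (fun h : y = 1 => hs (h ▸ hy)) _ _
  induction n generalizing s with
  | zero =>
    apply cases_one hT 1
    · simp only [Formula.subst, Formula.substAll, Term.substAll, Term.iterS_substAll,
        Term.numeral_substAll, hsub s hs, Function.update_self]
      exact contra (eq_imp (eq_symm (p_addZero hT _)) (.logic (.eqRefl _))) (p_iterS_ne hT 0 s)
    · simp only [Formula.subst, Formula.substAll, Term.substAll, Term.iterS_substAll,
        Term.numeral_substAll, hsub s hs, Function.update_self]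
      exact contra (eq_imp (eq_symm (p_addSucc_var hT _)) (.logic (.eqRefl _)))
        (p_succNeZero hT _)
  | succ n ih =>
    apply cases_one hT 1
    · simp only [Formula.subst, Formula.substAll, Term.substAll, Term.iterS_substAll,
        Term.numeral_substAll, hsub s hs, Function.update_self]
      exact contra (eq_imp (eq_symm (p_addZero hT _)) (.logic (.eqRefl _)))
        (p_iterS_ne hT (n + 1) s)
    · simp only [Formula.subst, Formula.substAll, Term.substAll, Term.iterS_substAll,
        Term.numeral_substAll, hsub s hs, Function.update_self]
      have := ih s.succ hs
      rw [Term.iterS_succ] at this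
      exact contra (imp_trans (eq_imp (eq_symm (p_addSucc_var hT _)) (.logic (.eqRefl _)))
        (p_succInj hT _ n)) this

theorem p_not_le (hT : Extends T PAVer) (n : ℕ) (s : Term) :
    Provable T (le (Term.iterS (n + 1) s) (Term.numeral n)).neg := by
  have h0 : Provable T (le (Term.iterS (n + 1) (Term.var 0)) (Term.numeral n)).neg := by
    have h1 := p_le hT (Term.iterS (n + 1) (Term.var 0)) n (by simp [Term.iterS_fv, Term.fv])
    have h2 := Provable.mp (.logic (.andE1 _ _)) h1
    refine contra h2 (neg_intro (.mp (.logic (.exE _ _ _ (by simp [Formula.fv]))) (.gen 2 ?_)))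
    apply neg_falsum
    have h3 := (p_iterS_add_ne hT n (Term.var 0) (by simp [Term.fv])).inst 1 (Term.var 2) (by trivial)
    simpa [Formula.subst, Formula.substAll, Term.substAll,
      Term.numeral_substAll, Term.iterS_substAll] using h3
  have h := h0.inst 0 s (by trivial)
  simpa [Formula.subst, Formula.substAll, Term.substAll,
      Term.numeral_substAll, Term.iterS_substAll] using h

theorem p_num_le (hT : Extends T PAVer) (m n : ℕ) (h : m ≤ n) :
    Provable T (le (Term.numeral m) (Term.numeral n)) := by
  have h1 := p_le hT (Term.numeral m) n (by simp [Term.numeral_fv])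
  refine .mp (.mp (.logic (.andE2 _ _)) h1) ?_
  refine .mp (.logic (.exI 2 (Term.numeral (n - m)) _ trivial)) ?_
  have := p_add hT m (n - m)
  rw [Nat.add_sub_cancel' h] at this
  simpa [Formula.subst, Formula.substAll, Term.substAll, Term.numeral_substAll] using this

theorem p_num_not_le (hT : Extends T PAVer) (m n : ℕ) (h : n < m) :
    Provable T (le (Term.numeral m) (Term.numeral n)).neg := by
  have := p_not_le hT n (Term.numeral (m - (n + 1)))
  rwa [Term.iterS_numeral, Nat.sub_add_cancel h] at this

/-- `T` decides `A`. -/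
def Dec (T : Set Formula) (A : Formula) : Prop := Provable T A ∨ Provable T A.neg

theorem le_imp {a b c : Term} (h : Provable T (eq b c)) :
    Provable T ((le a b).imp (le a c)) :=
  .mp (.mp (.logic (.eqLe _ _ _ _)) (.logic (.eqRefl _))) h

/-- Bounded universal statements with all instances provable are provable. -/
theorem p_ball (hT : Extends T PAVer) (x n : ℕ) (t : Term) (χ : Formula) (ht : t.fv = ∅)
    (hn : Provable T (eq t (Term.numeral n)))
    (h : ∀ k < n, Provable T (χ.subst x (Term.numeral k))) :
    Provable T ((lt (Term.var x) t).imp χ) := by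
  apply cases_many hT x n
  · intro k hk
    exact imp_intro (h k hk)
  · refine absurd_imp ?_
    simp only [Formula.lt, Formula.substAll, Term.substAll, Function.update_self,
      Term.substAll_closed t ht]
    exact contra (le_imp hn) (p_not_le hT n (Term.var x))

theorem subst_lt (x : ℕ) (t u : Term) (ht : t.fv = ∅) :
    (lt (Term.var x) t).subst x u = le u.succ t := by
  simp only [Formula.subst, Formula.lt, Formula.substAll, Term.substAll, Function.update_self,
      Term.substAll_closed t ht]

theorem p_lt_closed (hT : Extends T PAVer) (t : Term) (n k : ℕ) (hk : k < n)
    (hn : Provable T (eq t (Term.numeral n))) : Provable T (le (Term.numeral k).succ t) :=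
  .mp (le_imp (eq_symm hn)) (p_num_le hT (k + 1) n hk)

theorem bound_subst (t : Term) (x : ℕ) (hx : x ∉ t.fv) (v : ℕ → ℕ) :
    t.substAll (Function.update (numeralSubst v) x (Term.var x)) =
      t.substAll (numeralSubst v) := by
  apply Term.substAll_congr
  intro y hy
  exact Function.update_of_ne (fun h : y = x => hx (h ▸ hy)) _ _

theorem dec_ball (hT : Extends T PAVer) (x : ℕ) (t : Term) (φ : Formula) (hx : x ∉ t.fv)
    (ih : ∀ v, Dec T (φ.substAll (numeralSubst v))) (v : ℕ → ℕ) :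
    Dec T ((ball x t φ).substAll (numeralSubst v)) := by
  have hcl := Term.fv_numeralSubst t v
  have hn := p_val hT t v
  have e : (ball x t φ).substAll (numeralSubst v) =
      all x ((lt (Term.var x) (t.substAll (numeralSubst v))).imp
        (φ.substAll (Function.update (numeralSubst v) x (Term.var x)))) := by
    simp [Formula.ball, Formula.lt, Formula.substAll, Term.substAll, bound_subst t x hx v]
  rw [e]
  by_cases hall : ∀ k < t.val v, Provable T (φ.substAll (numeralSubst (Function.update v x k)))
  · left
    refine .gen x (p_ball hT x _ _ _ hcl hn ?_)
    intro k hk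
    rw [subst_numeralSubst]
    exact hall k hk
  · right
    push Not at hall
    obtain ⟨k, hk, hnk⟩ := hall
    have hneg := (ih (Function.update v x k)).resolve_left hnk
    rw [← subst_numeralSubst] at hneg
    have h1 := Provable.logic (T := T) (.allE x (Term.numeral k)
      ((lt (Term.var x) (t.substAll (numeralSubst v))).imp
        (φ.substAll (Function.update (numeralSubst v) x (Term.var x))))
      (freeFor_of_subset _ _ (by simp [Term.numeral_fv]) _))
    have h2 : Provable T ((lt (Term.var x) (t.substAll (numeralSubst v))).subst x
        (Term.numeral k)) := by
      rw [subst_lt _ _ _ hcl]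
      exact p_lt_closed hT _ _ _ hk hn
    exact contra (imp_mp h1 (imp_intro h2)) hneg

theorem dec_bex (hT : Extends T PAVer) (x : ℕ) (t : Term) (φ : Formula) (hx : x ∉ t.fv)
    (ih : ∀ v, Dec T (φ.substAll (numeralSubst v))) (v : ℕ → ℕ) :
    Dec T ((bex x t φ).substAll (numeralSubst v)) := by
  have hcl := Term.fv_numeralSubst t v
  have hn := p_val hT t v
  have e : (bex x t φ).substAll (numeralSubst v) =
      ex x ((lt (Term.var x) (t.substAll (numeralSubst v))).and
        (φ.substAll (Function.update (numeralSubst v) x (Term.var x)))) := by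
    simp [Formula.bex, Formula.lt, Formula.substAll, Term.substAll, bound_subst t x hx v]
  rw [e]
  by_cases hex : ∃ k < t.val v, Provable T (φ.substAll (numeralSubst (Function.update v x k)))
  · left
    obtain ⟨k, hk, hpk⟩ := hex
    rw [← subst_numeralSubst] at hpk
    have h2 : Provable T ((lt (Term.var x) (t.substAll (numeralSubst v))).subst x
        (Term.numeral k)) := by
      rw [subst_lt _ _ _ hcl]
      exact p_lt_closed hT _ _ _ hk hn
    exact .mp (.logic (.exI x (Term.numeral k) _
      (freeFor_of_subset _ _ (by simp [Term.numeral_fv]) _)))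
      (.mp (.mp (.logic (.andI _ _)) h2) hpk)
  · right
    push Not at hex
    have h1 := p_ball hT x _ _
      (φ.substAll (Function.update (numeralSubst v) x (Term.var x))).neg hcl hn (by
        intro k hk
        have := (ih (Function.update v x k)).resolve_left (hex k hk)
        rwa [← subst_numeralSubst] at this)
    refine neg_intro (.mp (.logic (.exE _ _ _ (by simp [Formula.fv]))) (.gen x ?_))
    have h3 := imp_trans (.logic (.andE1 _ (φ.substAll
      (Function.update (numeralSubst v) x (Term.var x))))) h1
    exact imp_mp (imp_trans h3 (.logic (.negElimFalsum _))) (.logic (.andE2 _ _))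

theorem dec_and {A B : Formula} (hA : Dec T A) (hB : Dec T B) : Dec T (A.and B) := by
  rcases hA with hA | hA
  · rcases hB with hB | hB
    · exact Or.inl (.mp (.mp (.logic (.andI _ _)) hA) hB)
    · exact Or.inr (contra (.logic (.andE2 _ _)) hB)
  · exact Or.inr (contra (.logic (.andE1 _ _)) hA)

theorem dec_or {A B : Formula} (hA : Dec T A) (hB : Dec T B) : Dec T (A.or B) := by
  rcases hA with hA | hA
  · exact Or.inl (.mp (.logic (.orI1 _ _)) hA)
  · rcases hB with hB | hB
    · exact Or.inl (.mp (.logic (.orI2 _ _)) hB)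
    · exact Or.inr (neg_intro
        (.mp (.mp (.logic (.orE _ _ _)) (neg_falsum hA)) (neg_falsum hB)))

theorem dec_neg {A : Formula} (hA : Dec T A) : Dec T A.neg := by
  rcases hA with hA | hA
  · refine Or.inr (neg_intro (imp_mp (.logic (.negElimFalsum _)) (imp_intro hA)))
  · exact Or.inl hA

theorem dec_imp {A B : Formula} (hA : Dec T A) (hB : Dec T B) : Dec T (A.imp B) := by
  rcases hB with hB | hB
  · exact Or.inl (imp_intro hB)
  · rcases hA with hA | hA
    · refine Or.inr (contra ?_ hB)
      exact imp_mp (imp_self _) (imp_intro hA)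
    · exact Or.inl (absurd_imp hA)

theorem dec_delta0 (hT : Extends T PAVer) {φ : Formula} (h : IsDelta0 φ) (v : ℕ → ℕ) :
    Dec T (φ.substAll (numeralSubst v)) := by
  induction h generalizing v with
  | falsum =>
    refine Or.inr (neg_intro (.logic (.falsumE _)))
  | eq t u =>
    have h1 := p_val hT t v
    have h2 := p_val hT u v
    by_cases h : t.val v = u.val v
    · left
      rw [h] at h1
      exact h1.eq_trans h2.eq_symm
    · exact Or.inr (contra (eq_imp h1.eq_symm h2) (p_num_ne hT _ _ h))
  | le t u =>
    have h1 := p_val hT t v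
    have h2 := p_val hT u v
    by_cases h : t.val v ≤ u.val v
    · left
      exact .mp (.mp (.mp (.logic (.eqLe _ _ _ _)) h1.eq_symm) h2.eq_symm) (p_num_le hT _ _ h)
    · right
      exact contra (.mp (.mp (.logic (.eqLe _ _ _ _)) h1) h2)
        (p_num_not_le hT _ _ (by omega))
  | and _ _ ih1 ih2 => exact dec_and (ih1 v) (ih2 v)
  | or _ _ ih1 ih2 => exact dec_or (ih1 v) (ih2 v)
  | imp _ _ ih1 ih2 => exact dec_imp (ih1 v) (ih2 v)
  | neg _ ih => exact dec_neg (ih v)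
  | ball hx _ ih => exact dec_ball hT _ _ _ hx ih v
  | bex hx _ ih => exact dec_bex hT _ _ _ hx ih v

theorem dec_deltaB (hT : Extends T PAVer) {φ : Formula} (h : IsDeltaB φ) (v : ℕ → ℕ) :
    Dec T (φ.substAll (numeralSubst v)) := by
  induction h generalizing v with
  | delta0 h => exact dec_delta0 hT h v
  | b ψ => exact Or.inl (box_provable hT _)
  | and _ _ ih1 ih2 => exact dec_and (ih1 v) (ih2 v)
  | or _ _ ih1 ih2 => exact dec_or (ih1 v) (ih2 v)
  | ball hx _ ih => exact dec_ball hT _ _ _ hx ih v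
  | bex hx _ ih => exact dec_bex hT _ _ _ hx ih v


/-- For a consistent r.e. extension T of PA(Ver) (with natural provability
predicate P): T is ΔB-DC iff T ⊬ ¬Con_T, where Con_T = ¬Pr_T(⌜⊥⌝). -/
theorem statement13 (T : Set Formula) (hre : RE T) (hT : Extends T PAVer)
    (hcon : Consistent T) (P : ProvPred T) :
    DC T P IsDeltaB ↔
      ¬ Provable T (Formula.neg (Formula.neg (P.app Formula.falsum))) := by
  constructor
  · intro hdc hp
    have h1 : Provable T (P.app Formula.falsum) := .mp (.logic (.dne _)) hp
    exact hcon (hdc Formula.falsum (.delta0 .falsum) rfl (.mp (.logic (.orI2 _ _)) h1))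
  · intro hnp φ hφ hs hor
    have hdec := dec_deltaB hT hφ fun _ => 0
    rw [Formula.substAll_eq_self φ _ (by rw [hs]; simp)] at hdec
    rcases hdec with h | h
    · exact h
    · exfalso
      apply hnp
      have hpr : Provable T (P.app φ) :=
        .mp (.mp (.mp (.logic (.orE _ _ _)) (absurd_imp h))
          (imp_self _))
          hor
      have h1 : Provable T (P.app (φ.imp Formula.falsum)) := ext_PA hT (P.d1 _ (neg_falsum h))
      have h2 : Provable T (P.app Formula.falsum) :=
        .mp (.mp (ext_PA hT (P.d2 φ Formula.falsum)) h1) hpr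
      exact (dec_neg (Or.inl h2)).resolve_left fun h3 =>
        hcon (.mp (neg_falsum h3) h2)

end ModalArith
end

section
/- Let T be any consistent recursively enumerable extension of PA(Ver). Then the following are pairwise equivalent: (1) T is Σ₁-sound; (2) T has ΣB-DP; (3) T has (ΣB, Σ₁)-DP; (4) T has ΣB-EP; (5) T has ΔB-EP; (6) T is ΣB-DC. -/
namespace ModalArith


/-! ### Syntax lemmas -/

/-- Strict upper bound for all variables of a term. -/
def Term.mx : Term → ℕ
  | .var x => x + 1
  | .zero => 0
  | .succ t => mx t
  | .add t u => max (mx t) (mx u)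
  | .mul t u => max (mx t) (mx u)

/-- Strict upper bound for all variables (free or bound) of a formula. -/
def Formula.mx : Formula → ℕ
  | .falsum => 0
  | .eq t u => max t.mx u.mx
  | .le t u => max t.mx u.mx
  | .and φ ψ => max (mx φ) (mx ψ)
  | .or φ ψ => max (mx φ) (mx ψ)
  | .imp φ ψ => max (mx φ) (mx ψ)
  | .neg φ => mx φ
  | .all x φ => max (x + 1) (mx φ)
  | .ex x φ => max (x + 1) (mx φ)
  | .box φ => mx φ

theorem Term.lt_mx {t : Term} {x : ℕ} (h : x ∈ t.fv) : x < t.mx := by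
  induction t <;> simp_all [Term.fv, Term.mx] <;> grind

theorem Formula.lt_mx {φ : Formula} {x : ℕ} (h : x ∈ φ.fv) : x < φ.mx := by
  induction φ with
  | eq t u | le t u =>
    simp only [Formula.fv, Finset.mem_union] at h
    simp only [Formula.mx, lt_max_iff]
    exact h.imp Term.lt_mx Term.lt_mx
  | _ => simp_all [Formula.fv, Formula.mx] <;> grind

theorem Term.substAll_congr_s14 {t : Term} {f g : ℕ → Term} (h : ∀ y ∈ t.fv, f y = g y) :
    t.substAll f = t.substAll g := by
  induction t <;> simp_all [Term.fv, Term.substAll]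

theorem Term.substAll_var_s14 (t : Term) : t.substAll Term.var = t := by
  induction t <;> simp_all [Term.substAll]

theorem Formula.substAll_congr_s14 {φ : Formula} {f g : ℕ → Term} (h : ∀ y ∈ φ.fv, f y = g y) :
    φ.substAll f = φ.substAll g := by
  induction φ generalizing f g with
  | falsum => rfl
  | eq t u | le t u =>
    simp only [Formula.fv, Finset.mem_union] at h
    simp only [Formula.substAll]
    rw [Term.substAll_congr_s14 (fun y hy => h y (Or.inl hy)),
      Term.substAll_congr_s14 (fun y hy => h y (Or.inr hy))]
  | and φ ψ ih1 ih2 | or φ ψ ih1 ih2 | imp φ ψ ih1 ih2 =>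
    simp only [Formula.fv, Finset.mem_union] at h
    simp only [Formula.substAll]
    rw [ih1 (fun y hy => h y (Or.inl hy)), ih2 (fun y hy => h y (Or.inr hy))]
  | neg φ ih | box φ ih =>
    simp only [Formula.substAll]; rw [ih h]
  | all x φ ih | ex x φ ih =>
    simp only [Formula.substAll]
    rw [ih]
    intro y hy
    by_cases hx : y = x
    · subst hx; simp
    · simp [hx]; exact h y (by simp [Formula.fv, hx, hy])

theorem update_var_self (x : ℕ) : Function.update Term.var x (Term.var x) = Term.var := by
  simp

theorem Formula.substAll_var_s14 (φ : Formula) : φ.substAll Term.var = φ := by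
  induction φ <;> simp_all [Formula.substAll, Term.substAll_var_s14]

theorem Formula.subst_self_s14 (φ : Formula) (x : ℕ) : φ.subst x (Term.var x) = φ := by
  simp [Formula.subst, Formula.substAll_var_s14]

theorem Formula.subst_notin {φ : Formula} {x : ℕ} (t : Term) (h : x ∉ φ.fv) :
    φ.subst x t = φ := by
  conv_rhs => rw [← Formula.substAll_var_s14 φ]
  apply Formula.substAll_congr_s14
  intro y hy
  have : y ≠ x := by rintro rfl; exact h hy
  simp [this]

theorem Formula.freeFor_self (φ : Formula) (x : ℕ) : φ.freeFor (Term.var x) x := by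
  induction φ <;> simp_all [Formula.freeFor, Term.fv]
  all_goals tauto

theorem Term.notin_fv_substAll {t : Term} {f : ℕ → Term} {x : ℕ}
    (h : ∀ y ∈ t.fv, x ∉ (f y).fv) : x ∉ (t.substAll f).fv := by
  induction t <;> simp_all [Term.fv, Term.substAll]

theorem Formula.notin_fv_substAll {φ : Formula} {f : ℕ → Term} {x : ℕ}
    (h : ∀ y ∈ φ.fv, x ∉ (f y).fv) : x ∉ (φ.substAll f).fv := by
  induction φ generalizing f with
  | falsum => simp [Formula.substAll, Formula.fv]
  | eq t u | le t u =>
    simp only [Formula.fv, Finset.mem_union] at h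
    simp only [Formula.substAll, Formula.fv, Finset.mem_union, not_or]
    exact ⟨Term.notin_fv_substAll (fun y hy => h y (Or.inl hy)),
      Term.notin_fv_substAll (fun y hy => h y (Or.inr hy))⟩
  | and φ ψ ih1 ih2 | or φ ψ ih1 ih2 | imp φ ψ ih1 ih2 =>
    simp only [Formula.fv, Finset.mem_union] at h
    simp only [Formula.substAll, Formula.fv, Finset.mem_union, not_or]
    exact ⟨ih1 (fun y hy => h y (Or.inl hy)), ih2 (fun y hy => h y (Or.inr hy))⟩
  | neg φ ih | box φ ih => exact ih h
  | all z φ ih | ex z φ ih =>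
    simp only [Formula.substAll, Formula.fv, Finset.mem_erase, not_and]
    intro hxz
    apply ih
    intro y hy
    by_cases hy2 : y = z
    · subst hy2; simpa [Term.fv] using hxz
    · simp only [ne_eq, hy2, not_false_eq_true, Function.update_of_ne]
      exact h y (by simp [Formula.fv, hy2, hy])

theorem Term.subst_fresh_back (t : Term) {x c : ℕ} (hc : t.mx ≤ c) :
    (t.substAll (Function.update Term.var x (Term.var c))).substAll
      (Function.update Term.var c (Term.var x)) = t := by
  induction t with
  | var y =>
    simp only [Term.mx] at hc
    by_cases h : y = x
    · subst h; simp [Term.substAll]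
    · have : y ≠ c := by omega
      simp [Term.substAll, h, this]
  | _ => simp_all [Term.substAll, Term.mx]

theorem Formula.subst_fresh_back (φ : Formula) {x c : ℕ} (hc : φ.mx ≤ c) :
    (φ.subst x (Term.var c)).subst c (Term.var x) = φ := by
  induction φ with
  | falsum => rfl
  | eq t u | le t u =>
    simp only [Formula.mx, max_le_iff] at hc
    have h1 := Term.subst_fresh_back t (x := x) hc.1
    have h2 := Term.subst_fresh_back u (x := x) hc.2
    simp_all [Formula.subst, Formula.substAll]
  | all y φ ih | ex y φ ih =>
    simp only [Formula.mx, max_le_iff] at hc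
    have ih := ih hc.2
    have hyc : y ≠ c := by omega
    simp only [Formula.subst, Formula.substAll]
    congr 1
    by_cases h : y = x
    · subst h
      rw [Function.update_idem, update_var_self, Formula.substAll_var_s14,
        Function.update_comm (Ne.symm hyc), update_var_self]
      exact Formula.subst_notin _ (fun h => by have := Formula.lt_mx h; omega)
    · rw [Function.update_comm (Ne.symm h), update_var_self, 
        Function.update_comm (Ne.symm hyc), update_var_self]
      exact ih
  | _ => simp_all [Formula.subst, Formula.substAll, Formula.mx]

theorem Formula.freeFor_fresh_back (φ : Formula) {x c : ℕ} (hc : φ.mx ≤ c) :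
    (φ.subst x (Term.var c)).freeFor (Term.var x) c := by
  induction φ with
  | all y φ ih | ex y φ ih =>
    simp only [Formula.mx, max_le_iff] at hc
    have ih := ih hc.2
    simp only [Formula.subst, Formula.substAll, Formula.freeFor]
    by_cases h : y = x
    · subst h
      right; left
      rw [Function.update_idem, update_var_self, Formula.substAll_var_s14]
      exact (fun h => by have := Formula.lt_mx h; omega)
    · right; right
      rw [Function.update_comm (Ne.symm h), update_var_self]
      exact ⟨by simpa [Term.fv] using h, ih⟩
  | _ => simp_all [Formula.subst, Formula.substAll, Formula.mx, Formula.freeFor]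

theorem Formula.freeFor_large {K : ℕ} (φ : Formula) (f : ℕ → Term) (x : ℕ) {t : Term}
    (hφ : φ.mx ≤ K) (ht : ∀ y ∈ t.fv, K ≤ y) : (φ.substAll f).freeFor t x := by
  induction φ generalizing f with
  | all y φ ih | ex y φ ih =>
    simp only [Formula.mx, max_le_iff] at hφ
    simp only [Formula.substAll, Formula.freeFor]
    right; right
    exact ⟨fun h => by have := ht y h; omega, ih _ hφ.2⟩
  | _ => simp_all [Formula.substAll, Formula.mx, Formula.freeFor]

theorem Term.substAll_comp_s14 (t : Term) (f g : ℕ → Term) :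
    (t.substAll f).substAll g = t.substAll (fun y => (f y).substAll g) := by
  induction t <;> simp_all [Term.substAll]

theorem Formula.substAll_comp_s14 {K : ℕ} (φ : Formula) (f g : ℕ → Term) (hφ : φ.mx ≤ K)
    (hf : ∀ y, f y = Term.var y ∨ ∀ z ∈ (f y).fv, K ≤ z) (hg : ∀ y, K ≤ y → g y = Term.var y) :
    (φ.substAll f).substAll g = φ.substAll (fun y => (f y).substAll g) := by
  induction φ generalizing f g with
  | all x φ ih | ex x φ ih =>
    simp only [Formula.mx, max_le_iff] at hφ
    simp only [Formula.substAll]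
    rw [ih _ _ hφ.2]
    · congr 2
      funext y
      by_cases h : y = x
      · subst h; simp [Term.substAll]
      · simp only [ne_eq, h, not_false_eq_true, Function.update_of_ne]
        rcases hf y with h1 | h1
        · rw [h1]; simp [Term.substAll, h]
        · apply Term.substAll_congr_s14
          intro z hz
          have := h1 z hz
          rw [Function.update_of_ne (by omega)]
    · intro y
      by_cases h : y = x
      · subst h; simp
      · simpa [h] using hf y
    · intro y hy
      rw [Function.update_of_ne (by omega)]
      exact hg y hy
  | _ => simp_all [Formula.substAll, Formula.mx, Term.substAll_comp_s14]

/-! ### Countability -/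

theorem Term.code_inj : ∀ {t u : Term}, t.code = u.code → t = u := by
  intro t
  induction t <;> intro u h <;> cases u <;> simp_all [Term.code, Nat.pair_eq_pair]
  all_goals grind

theorem Formula.code_inj : ∀ {φ ψ : Formula}, φ.code = ψ.code → φ = ψ := by
  intro φ
  induction φ <;> intro ψ h <;> cases ψ <;> simp_all [Formula.code, Nat.pair_eq_pair]
  case eq.eq => exact ⟨Term.code_inj h.1, Term.code_inj h.2⟩
  case le.le => exact ⟨Term.code_inj h.1, Term.code_inj h.2⟩
  all_goals grind

instance : Countable Formula :=
  Function.Injective.countable (f := Formula.code) (fun _ _ h => Formula.code_inj h)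


/-! ### Propositional toolkit -/

section Hilbert

variable {T : Set Formula}

theorem Provable.k {φ ψ : Formula} (h : Provable T ψ) : Provable T (φ.imp ψ) :=
  .mp (.logic (.imp1 _ _)) h

theorem Provable.s {γ φ ψ : Formula} (h : Provable T (γ.imp (φ.imp ψ)))
    (h2 : Provable T (γ.imp φ)) : Provable T (γ.imp ψ) :=
  .mp (.mp (.logic (.imp2 _ _ _)) h) h2

theorem Provable.idd (φ : Formula) : Provable T (φ.imp φ) :=
  .s (.logic (.imp1 φ (φ.imp φ))) (.logic (.imp1 _ _))

theorem Provable.tr {φ ψ χ : Formula} (h : Provable T (φ.imp ψ)) (h2 : Provable T (ψ.imp χ)) :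
    Provable T (φ.imp χ) := .s (.k h2) h

theorem Provable.curry {γ φ ψ : Formula} (h : Provable T ((γ.and φ).imp ψ)) :
    Provable T (γ.imp (φ.imp ψ)) :=
  .tr (.logic (.andI γ φ)) (.mp (.logic (.imp2 _ _ _)) (.k h))

theorem Provable.uncurry {γ φ ψ : Formula} (h : Provable T (γ.imp (φ.imp ψ))) :
    Provable T ((γ.and φ).imp ψ) :=
  .s (.tr (.logic (.andE1 γ φ)) h) (.logic (.andE2 γ φ))

theorem Provable.swap {γ φ ψ : Formula} (h : Provable T (γ.imp (φ.imp ψ))) :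
    Provable T (φ.imp (γ.imp ψ)) :=
  .tr (.logic (.imp1 φ γ)) (.mp (.logic (.imp2 _ _ _)) h)

theorem Provable.exMono {x : ℕ} {φ ψ : Formula} (h : Provable T (φ.imp ψ)) (hx : x ∉ ψ.fv) :
    Provable T ((Formula.ex x φ).imp ψ) :=
  .mp (.logic (.exE x φ ψ hx)) (.gen x h)

theorem Provable.notAll (x : ℕ) (θ : Formula) :
    Provable T ((Formula.all x θ).neg.imp (Formula.ex x θ.neg)) := by
  have h1 : Provable T (θ.neg.imp (Formula.ex x θ.neg)) := by
    have := Provable.logic (T := T) (.exI x (.var x) θ.neg (Formula.freeFor_self _ _))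
    rwa [Formula.subst_self_s14] at this
  set E := Formula.ex x θ.neg with hE
  -- from `¬E` infer `¬¬θ`, hence `θ`
  have h2 : Provable T (E.neg.imp θ) := by
    refine .tr ?_ (.logic (.dne θ))
    refine .tr ?_ (.logic (.negIntro _))
    refine .swap ?_
    exact .tr h1 (.swap (.logic (.negElimFalsum E)))
  have h3 : Provable T (E.neg.imp (Formula.all x θ)) :=
    .mp (.logic (.allImp x _ _ (by simp [hE, Formula.fv]))) (.gen x h2)
  refine .tr ?_ (.logic (.dne E))
  refine .tr ?_ (.logic (.negIntro _))
  exact .swap (.tr h3 (.swap (.logic (.negElimFalsum _))))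

/-- One Henkin step. -/
theorem henkin_step (K : ℕ) (γ ψ : Formula) (hγ : ¬ Provable T (γ.imp .falsum)) :
    ∃ γ' : Formula, ¬ Provable T (γ'.imp .falsum) ∧ Provable T (γ'.imp γ) ∧
      (Provable T (γ'.imp ψ.neg) ∨ (Provable T (γ'.imp ψ) ∧
        ∀ x θ, ψ = Formula.ex x θ →
          ∃ c, K ≤ c ∧ Provable T (γ'.imp (θ.subst x (Term.var c))))) := by
  by_cases h : Provable T ((γ.and ψ).imp .falsum)
  · exact ⟨γ, hγ, .idd γ, Or.inl (.tr h.curry (.logic (.negIntro ψ)))⟩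
  by_cases hex : ∃ x θ, ψ = Formula.ex x θ
  · obtain ⟨x, θ, rfl⟩ := hex
    set γ1 := γ.and (Formula.ex x θ) with hγ1
    let c := max K (max γ1.mx (Formula.ex x θ).mx)
    have hc1 : γ1.mx ≤ c := by simp [c]
    have hc2 : (Formula.ex x θ).mx ≤ c := by simp [c]
    have hc3 : x + 1 ≤ c ∧ θ.mx ≤ c := by simpa [Formula.mx] using hc2
    refine ⟨γ1.and (θ.subst x (Term.var c)), ?_, .tr (.logic (.andE1 _ _)) (.logic (.andE1 _ _)),
      Or.inr ⟨.tr (.logic (.andE1 _ _)) (.logic (.andE2 _ _)), ?_⟩⟩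
    · intro hbad
      apply h
      have h1 : Provable T ((Formula.ex c (θ.subst x (Term.var c))).imp (γ1.imp .falsum)) := by
        apply Provable.exMono hbad.curry.swap
        intro hmem
        simp only [Formula.fv, Finset.union_empty] at hmem
        have := Formula.lt_mx hmem
        omega
      have h2 : Provable T ((Formula.ex x θ).imp (Formula.ex c (θ.subst x (Term.var c)))) := by
        apply Provable.exMono
        · have := Provable.logic (T := T) (.exI c (.var x) (θ.subst x (Term.var c))
            (Formula.freeFor_fresh_back θ hc3.2))
          rwa [Formula.subst_fresh_back θ hc3.2] at this
        · simp only [Formula.fv, Finset.mem_erase, not_and]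
          intro hxc
          apply Formula.notin_fv_substAll
          intro y _
          by_cases hy : y = x
          · subst hy; simpa [Term.fv] using hxc
          · simp [hy, Term.fv, Ne.symm hy]
      have h3 : Provable T (γ1.imp (γ1.imp .falsum)) :=
        .tr (.tr (.logic (.andE2 _ _)) h2) h1
      exact .s h3 (.idd _)
    · intro x' θ' he
      cases he
      exact ⟨c, by simp [c], .logic (.andE2 _ _)⟩
  · exact ⟨γ.and ψ, h, .logic (.andE1 _ _), Or.inr ⟨.logic (.andE2 _ _),
      fun x θ he => (hex ⟨x, θ, he⟩).elim⟩⟩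

/-- A Henkin-complete set of formulas. -/
structure Henkin (T : Set Formula) (K : ℕ) (H : Formula → Prop) : Prop where
  thm : ∀ {φ}, Provable T φ → H φ
  mp : ∀ {φ ψ}, H (φ.imp ψ) → H φ → H ψ
  cons : ¬ H .falsum
  compl : ∀ φ, H φ ∨ H φ.neg
  wit : ∀ x θ, H (.ex x θ) → ∃ c, K ≤ c ∧ H (θ.subst x (Term.var c))

theorem exists_henkin (K : ℕ) (γ : Formula) (hγ : ¬ Provable T (γ.imp .falsum)) :
    ∃ H, Henkin T K H ∧ H γ := by
  classical
  have : Nonempty Formula := ⟨.falsum⟩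
  obtain ⟨e, he⟩ := exists_surjective_nat Formula
  let S := {γ : Formula // ¬ Provable T (γ.imp .falsum)}
  have step : ∀ (g : S) (n : ℕ), ∃ g' : S, Provable T (g'.1.imp g.1) ∧
      (Provable T (g'.1.imp (e n).neg) ∨ (Provable T (g'.1.imp (e n)) ∧
        ∀ x θ, e n = Formula.ex x θ →
          ∃ c, K ≤ c ∧ Provable T (g'.1.imp (θ.subst x (Term.var c))))) := by
    intro g n
    obtain ⟨γ', h1, h2, h3⟩ := henkin_step K g.1 (e n) g.2
    exact ⟨⟨γ', h1⟩, h2, h3⟩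
  choose nx hnx1 hnx2 using step
  let G : ℕ → S := fun n => Nat.rec ⟨γ, hγ⟩ (fun n g => nx g n) n
  have hG : ∀ n, G (n + 1) = nx (G n) n := fun n => rfl
  have mono : ∀ n k, Provable T ((G (n + k)).1.imp (G n).1) := by
    intro n k
    induction k with
    | zero => exact .idd _
    | succ k ih => exact .tr (by rw [← Nat.add_assoc, hG]; exact hnx1 _ _) ih
  have mono' : ∀ n m, n ≤ m → Provable T ((G m).1.imp (G n).1) := by
    intro n m h
    obtain ⟨k, rfl⟩ := Nat.exists_eq_add_of_le h
    exact mono n k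
  have hmp : ∀ {φ ψ : Formula}, (∃ n, Provable T ((G n).1.imp (φ.imp ψ))) →
      (∃ n, Provable T ((G n).1.imp φ)) → (∃ n, Provable T ((G n).1.imp ψ)) := by
    rintro φ ψ ⟨n, hn⟩ ⟨m, hm⟩
    exact ⟨max n m, .s (.tr (mono' _ _ (le_max_left _ _)) hn)
      (.tr (mono' _ _ (le_max_right _ _)) hm)⟩
  have hcons : ¬ ∃ n, Provable T ((G n).1.imp .falsum) := by
    rintro ⟨n, hn⟩
    exact (G n).2 hn
  refine ⟨fun φ => ∃ n, Provable T ((G n).1.imp φ), ⟨fun h => ⟨0, .k h⟩, hmp, hcons, ?_, ?_⟩,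
    ⟨0, .idd _⟩⟩
  · intro φ
    obtain ⟨n, rfl⟩ := he φ
    rcases hnx2 (G n) n with h | h
    · exact Or.inr ⟨n + 1, h⟩
    · exact Or.inl ⟨n + 1, h.1⟩
  · intro x θ hH
    obtain ⟨n, hn⟩ := he (.ex x θ)
    rcases hnx2 (G n) n with h | h
    · exfalso
      apply hcons
      rw [hn] at h
      exact hmp (hmp ⟨0, .k (.logic (.negElimFalsum (.ex x θ)))⟩ ⟨n + 1, h⟩) hH
    · obtain ⟨c, hc, h⟩ := h.2 x θ hn
      exact ⟨c, hc, n + 1, h⟩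

end Hilbert

section HenkinLemmas

variable {T : Set Formula} {K : ℕ} {H : Formula → Prop}

theorem Henkin.neg_iff (hH : Henkin T K H) (φ : Formula) : H φ.neg ↔ ¬ H φ := by
  constructor
  · intro h h2
    exact hH.cons (hH.mp (hH.mp (hH.thm (.logic (.negElimFalsum φ))) h) h2)
  · intro h
    exact (hH.compl φ).resolve_left h

theorem Henkin.imp_iff (hH : Henkin T K H) (φ ψ : Formula) : H (φ.imp ψ) ↔ (H φ → H ψ) := by
  constructor
  · exact fun h => hH.mp h
  · intro h
    by_cases h2 : H φ
    · exact hH.mp (hH.thm (.logic (.imp1 _ _))) (h h2)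
    · exact hH.mp (hH.thm (.logic (.negE _ _))) ((hH.neg_iff φ).2 h2)

theorem Henkin.and_iff (hH : Henkin T K H) (φ ψ : Formula) : H (φ.and ψ) ↔ (H φ ∧ H ψ) := by
  constructor
  · exact fun h => ⟨hH.mp (hH.thm (.logic (.andE1 _ _))) h, hH.mp (hH.thm (.logic (.andE2 _ _))) h⟩
  · exact fun h => hH.mp (hH.mp (hH.thm (.logic (.andI _ _))) h.1) h.2

theorem Henkin.or_iff (hH : Henkin T K H) (φ ψ : Formula) : H (φ.or ψ) ↔ (H φ ∨ H ψ) := by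
  constructor
  · intro h
    by_contra hn
    rw [not_or] at hn
    have h1 : H (φ.imp .falsum) := (hH.imp_iff _ _).2 (fun h => (hn.1 h).elim)
    have h2 : H (ψ.imp .falsum) := (hH.imp_iff _ _).2 (fun h => (hn.2 h).elim)
    exact hH.cons (hH.mp (hH.mp (hH.mp (hH.thm (.logic (.orE _ _ _))) h1) h2) h)
  · rintro (h | h)
    · exact hH.mp (hH.thm (.logic (.orI1 _ _))) h
    · exact hH.mp (hH.thm (.logic (.orI2 _ _))) h

end HenkinLemmas

/-! ### Structures -/

/-- A structure for the language of arithmetic. -/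
structure Str where
  M : Type
  z : M
  s : M → M
  a : M → M → M
  m : M → M → M
  le : M → M → Prop

/-- Value of a term. -/
def Str.tval (A : Str) : Term → (ℕ → A.M) → A.M
  | .var x, v => v x
  | .zero, _ => A.z
  | .succ t, v => A.s (tval A t v)
  | .add t u, v => A.a (tval A t v) (tval A u v)
  | .mul t u, v => A.m (tval A t v) (tval A u v)

/-- Satisfaction, with boxed formulas interpreted as true. -/
def Str.sat (A : Str) : Formula → (ℕ → A.M) → Prop
  | .falsum, _ => False
  | .eq t u, v => A.tval t v = A.tval u v
  | .le t u, v => A.le (A.tval t v) (A.tval u v)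
  | .and φ ψ, v => sat A φ v ∧ sat A ψ v
  | .or φ ψ, v => sat A φ v ∨ sat A ψ v
  | .imp φ ψ, v => sat A φ v → sat A ψ v
  | .neg φ, v => ¬ sat A φ v
  | .all x φ, v => ∀ n, sat A φ (Function.update v x n)
  | .ex x φ, v => ∃ n, sat A φ (Function.update v x n)
  | .box _, _ => True

/-- `A` satisfies all theorems of `T` with variables below `K`. -/
def TModel (T : Set Formula) (K : ℕ) (A : Str) : Prop :=
  ∀ ψ : Formula, ψ.mx ≤ K → Provable T ψ → ∀ v, A.sat ψ v

section TermModel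

variable {T : Set Formula} {K : ℕ} {H : Formula → Prop} (hH : Henkin T K H)

/-- Terms all of whose variables are at least `K`. -/
def Elem (K : ℕ) : Type := {t : Term // ∀ y ∈ t.fv, K ≤ y}

/-- Equality of terms according to `H`. -/
def elemSetoid (hH : Henkin T K H) : Setoid (Elem K) where
  r t u := H (.eq t.1 u.1)
  iseqv :=
    { refl := fun _ => hH.thm (.logic (.eqRefl _))
      symm := fun h => hH.mp (hH.thm (.logic (.eqSymm _ _))) h
      trans := fun h h2 => hH.mp (hH.mp (hH.thm (.logic (.eqTrans _ _ _))) h) h2 }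

/-- The term model. -/
def termModel (hH : Henkin T K H) : Str where
  M := Quotient (elemSetoid hH)
  z := Quotient.mk (elemSetoid hH) ⟨.zero, by simp [Term.fv]⟩
  s := Quotient.map (fun t => ⟨.succ t.1, t.2⟩)
    (fun _ _ h => hH.mp (hH.thm (.logic (.eqSucc _ _))) h)
  a := Quotient.map₂ (fun t u => ⟨.add t.1 u.1, by
      intro y hy
      simp only [Term.fv, Finset.mem_union] at hy
      exact hy.elim (t.2 y) (u.2 y)⟩)
    (fun _ _ h _ _ h2 => hH.mp (hH.mp (hH.thm (.logic (.eqAdd _ _ _ _))) h) h2)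
  m := Quotient.map₂ (fun t u => ⟨.mul t.1 u.1, by
      intro y hy
      simp only [Term.fv, Finset.mem_union] at hy
      exact hy.elim (t.2 y) (u.2 y)⟩)
    (fun _ _ h _ _ h2 => hH.mp (hH.mp (hH.thm (.logic (.eqMul _ _ _ _))) h) h2)
  le := Quotient.lift₂ (fun t u => H (.le t.1 u.1)) (fun _ _ _ _ h h2 => propext
    ⟨fun h3 => hH.mp (hH.mp (hH.mp (hH.thm (.logic (.eqLe _ _ _ _))) h) h2) h3,
     fun h3 => hH.mp (hH.mp (hH.mp (hH.thm (.logic (.eqLe _ _ _ _)))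
      ((elemSetoid hH).iseqv.symm h)) ((elemSetoid hH).iseqv.symm h2)) h3⟩)

/-- A large variable as an element. -/
def varElem (c : ℕ) (hc : K ≤ c) : Elem K :=
  ⟨.var c, fun y hy => by rw [Term.fv, Finset.mem_singleton] at hy; exact hy ▸ hc⟩

/-- The class of a term. -/
def tmk (hH : Henkin T K H) (t : Elem K) : (termModel hH).M := Quotient.mk (elemSetoid hH) t

theorem tmk_rep (q : (termModel hH).M) : ∃ t, tmk hH t = q := Quotient.exists_rep q

theorem elem_substAll (t : Term) (v : ℕ → Elem K) :
    ∀ y ∈ (t.substAll (fun x => (v x).1)).fv, K ≤ y := by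
  induction t with
  | var x => exact (v x).2
  | zero => simp [Term.substAll, Term.fv]
  | succ t ih => exact ih
  | add t u ih1 ih2 | mul t u ih1 ih2 =>
    intro y hy
    simp only [Term.substAll, Term.fv, Finset.mem_union] at hy
    exact hy.elim (ih1 y) (ih2 y)

theorem termModel_tval (t : Term) (v : ℕ → Elem K) :
    (termModel hH).tval t (fun x => tmk hH (v x)) =
      tmk hH ⟨t.substAll (fun x => (v x).1), elem_substAll t v⟩ := by
  induction t with
  | var x => rfl
  | zero => rfl
  | succ t ih => simp only [Str.tval, ih]; rfl
  | add t u ih1 ih2 | mul t u ih1 ih2 => simp only [Str.tval, ih1, ih2]; rfl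

theorem upd_mk (v : ℕ → Elem K) (x : ℕ) (t : Elem K) :
    Function.update (fun x => tmk hH (v x)) x
      (tmk hH t) =
    fun y => tmk hH (Function.update v x t y) := by
  funext y
  by_cases h : y = x
  · subst h; simp
  · simp [h]

theorem subst_upd (φ : Formula) (hφ : φ.mx ≤ K) (v : ℕ → Elem K) (x : ℕ) (hx : x < K)
    (t : Elem K) :
    (φ.substAll (Function.update (fun x => (v x).1) x (Term.var x))).subst x t.1 =
      φ.substAll (fun y => (Function.update v x t y).1) := by
  unfold Formula.subst
  rw [Formula.substAll_comp_s14 (K := K) _ _ _ hφ]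
  · congr 1
    funext y
    by_cases h : y = x
    · subst h; simp [Term.substAll]
    · simp only [ne_eq, h, not_false_eq_true, Function.update_of_ne]
      conv_rhs => rw [← Term.substAll_var_s14 (v y).1]
      apply Term.substAll_congr_s14
      intro z hz
      have := (v y).2 z hz
      rw [Function.update_of_ne (by omega)]
  · intro y
    by_cases h : y = x
    · subst h; simp
    · right; simpa [h] using (v y).2
  · intro y hy
    rw [Function.update_of_ne (by omega)]

theorem truth (hbox : ∀ ψ, Provable T (.box ψ)) (φ : Formula) (hφ : φ.mx ≤ K) (v : ℕ → Elem K) :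
    (termModel hH).sat φ (fun x => tmk hH (v x)) ↔
      H (φ.substAll (fun x => (v x).1)) := by
  induction φ generalizing v with
  | falsum => exact ⟨False.elim, hH.cons⟩
  | eq t u =>
    simp only [Str.sat, termModel_tval, Formula.substAll]
    exact Quotient.eq (r := elemSetoid hH)
  | le t u =>
    simp only [Str.sat, termModel_tval, Formula.substAll]
    exact Iff.rfl
  | and φ ψ ih1 ih2 =>
    simp only [Formula.mx, max_le_iff] at hφ
    simp only [Str.sat, Formula.substAll, hH.and_iff, ih1 hφ.1, ih2 hφ.2]
  | or φ ψ ih1 ih2 =>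
    simp only [Formula.mx, max_le_iff] at hφ
    simp only [Str.sat, Formula.substAll, hH.or_iff, ih1 hφ.1, ih2 hφ.2]
  | imp φ ψ ih1 ih2 =>
    simp only [Formula.mx, max_le_iff] at hφ
    simp only [Str.sat, Formula.substAll, hH.imp_iff, ih1 hφ.1, ih2 hφ.2]
  | neg φ ih =>
    simp only [Str.sat, Formula.substAll, hH.neg_iff, ih hφ]
  | box φ ih =>
    simp only [Str.sat, Formula.substAll, true_iff]
    exact hH.thm (hbox _)
  | all x φ ih =>
    simp only [Formula.mx, max_le_iff] at hφ
    simp only [Str.sat, Formula.substAll]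
    constructor
    · intro h
      by_contra hn
      have h1 := hH.mp (hH.thm (.notAll _ _)) ((hH.neg_iff _).2 hn)
      obtain ⟨c, hc, h2⟩ := hH.wit _ _ h1
      have h3 := h (tmk hH (varElem c hc))
      rw [upd_mk, ih hφ.2, ← subst_upd _ hφ.2 _ _ (by omega)] at h3
      exact (hH.neg_iff _).1 h2 h3
    · intro h q
      obtain ⟨t, rfl⟩ := tmk_rep hH q
      rw [upd_mk, ih hφ.2, ← subst_upd _ hφ.2 _ _ (by omega)]
      exact hH.mp (hH.thm (.logic (.allE _ _ _ (Formula.freeFor_large _ _ _ hφ.2 t.2)))) h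
  | ex x φ ih =>
    simp only [Formula.mx, max_le_iff] at hφ
    simp only [Str.sat, Formula.substAll]
    constructor
    · rintro ⟨q, h⟩
      obtain ⟨t, rfl⟩ := tmk_rep hH q
      rw [upd_mk, ih hφ.2, ← subst_upd _ hφ.2 _ _ (by omega)] at h
      exact hH.mp (hH.thm (.logic (.exI _ _ _ (Formula.freeFor_large _ _ _ hφ.2 t.2)))) h
    · intro h
      obtain ⟨c, hc, h2⟩ := hH.wit _ _ h
      refine ⟨tmk hH (varElem c hc), ?_⟩
      rw [upd_mk, ih hφ.2, ← subst_upd _ hφ.2 _ _ (by omega)]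
      exact h2

theorem provable_substAll (φ : Formula) (hφ : φ.mx ≤ K) (v : ℕ → Elem K) (h : Provable T φ) :
    Provable T (φ.substAll (fun x => (v x).1)) := by
  have key : ∀ k, k ≤ K → Provable T (φ.substAll
      (fun x => if x < k then (v x).1 else Term.var x)) := by
    intro k
    induction k with
    | zero =>
      intro _
      have : (fun x => if x < 0 then (v x).1 else Term.var x) = Term.var := by funext x; simp
      rw [this, Formula.substAll_var_s14]; exact h
    | succ k ih =>
      intro hk
      have h1 := (ih (by omega)).gen k
      have h2 := Provable.mp (.logic (.allE k (v k).1 _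
        (Formula.freeFor_large _ _ _ hφ (v k).2))) h1
      unfold Formula.subst at h2
      rw [Formula.substAll_comp_s14 (K := K) _ _ _ hφ] at h2
      · convert h2 using 2
        funext y
        by_cases h3 : y < k
        · rw [if_pos (by omega), if_pos h3]
          conv_lhs => rw [← Term.substAll_var_s14 (v y).1]
          apply Term.substAll_congr_s14
          intro z hz
          have := (v y).2 z hz
          rw [Function.update_of_ne (by omega)]
        · rw [if_neg h3]
          by_cases h4 : y = k
          · subst h4; simp [Term.substAll]
          · rw [if_neg (by omega)]; simp [Term.substAll, h4]
      · intro y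
        by_cases h3 : y < k
        · right; simpa [h3] using (v y).2
        · left; simp [h3]
      · intro y hy
        rw [Function.update_of_ne (by omega)]
  have h1 := key K le_rfl
  convert h1 using 1
  apply Formula.substAll_congr_s14
  intro y hy
  have := Formula.lt_mx hy
  rw [if_pos (by omega)]

end TermModel

/-- Completeness. -/
theorem completeness {T : Set Formula} (hbox : ∀ ψ, Provable T (.box ψ)) (K : ℕ) (φ : Formula)
    (hφ : φ.mx ≤ K) (hs : Sentence φ) (h : ∀ A, TModel T K A → ∀ v, A.sat φ v) :
    Provable T φ := by
  by_contra hn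
  have h1 : ¬ Provable T (φ.neg.imp .falsum) := by
    intro hb
    exact hn (.mp (.logic (.dne φ)) (.mp (.logic (.negIntro _)) hb))
  obtain ⟨H, hH, hγ⟩ := exists_henkin K φ.neg h1
  have hm : TModel T K (termModel hH) := by
    intro ψ hψ hp v
    choose w hw using fun x => tmk_rep hH (v x)
    have hv : v = fun x => tmk hH (w x) := by
      funext x; rw [hw]
    rw [hv, truth hH hbox ψ hψ]
    exact hH.thm (provable_substAll ψ hψ _ hp)
  let v0 : ℕ → Elem K := fun _ => ⟨.zero, by simp [Term.fv]⟩
  have h2 := (truth hH hbox φ hφ v0).1 (h _ hm _)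
  have h3 : φ.substAll (fun x => (v0 x).1) = φ := by
    conv_rhs => rw [← Formula.substAll_var_s14 φ]
    apply Formula.substAll_congr_s14
    intro y hy
    rw [hs] at hy; simp at hy
  rw [h3] at h2
  exact (hH.neg_iff φ).1 hγ h2


/-! ### Semantic lemmas -/

theorem Str.tval_congr (A : Str) {t : Term} {v w : ℕ → A.M} (h : ∀ y ∈ t.fv, v y = w y) :
    A.tval t v = A.tval t w := by
  induction t <;> simp_all [Term.fv, Str.tval]

theorem Str.sat_congr (A : Str) {φ : Formula} {v w : ℕ → A.M} (h : ∀ y ∈ φ.fv, v y = w y) :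
    A.sat φ v ↔ A.sat φ w := by
  induction φ generalizing v w with
  | falsum => rfl
  | box φ => rfl
  | eq t u | le t u =>
    simp only [Formula.fv, Finset.mem_union] at h
    simp only [Str.sat]
    rw [A.tval_congr (fun y hy => h y (Or.inl hy)), A.tval_congr (fun y hy => h y (Or.inr hy))]
  | and φ ψ ih1 ih2 | or φ ψ ih1 ih2 | imp φ ψ ih1 ih2 =>
    simp only [Formula.fv, Finset.mem_union] at h
    simp only [Str.sat]
    rw [ih1 (fun y hy => h y (Or.inl hy)), ih2 (fun y hy => h y (Or.inr hy))]
  | neg φ ih =>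
    simp only [Str.sat]; rw [ih h]
  | all x φ ih | ex x φ ih =>
    simp only [Str.sat]
    have key : ∀ a, A.sat φ (Function.update v x a) ↔ A.sat φ (Function.update w x a) := by
      intro a
      apply ih
      intro y hy
      by_cases hx : y = x
      · subst hx; simp
      · simp only [ne_eq, hx, not_false_eq_true, Function.update_of_ne]
        exact h y (by simp [Formula.fv, hx, hy])
    simp only [key]

theorem Str.sat_upd_notin (A : Str) {φ : Formula} {x : ℕ} (hx : x ∉ φ.fv) (v : ℕ → A.M) (a : A.M) :
    A.sat φ (Function.update v x a) ↔ A.sat φ v := by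
  apply A.sat_congr
  intro y hy
  rw [Function.update_of_ne]
  rintro rfl
  exact hx hy

theorem Str.tval_upd_notin (A : Str) {t : Term} {x : ℕ} (hx : x ∉ t.fv) (v : ℕ → A.M) (a : A.M) :
    A.tval t (Function.update v x a) = A.tval t v := by
  apply A.tval_congr
  intro y hy
  rw [Function.update_of_ne]
  rintro rfl
  exact hx hy

theorem Str.tval_substAll (A : Str) (t : Term) (f : ℕ → Term) (v : ℕ → A.M) :
    A.tval (t.substAll f) v = A.tval t (fun y => A.tval (f y) v) := by
  induction t <;> simp_all [Term.substAll, Str.tval]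

theorem Str.sat_substAll (A : Str) (φ : Formula) (f : ℕ → Term) (v : ℕ → A.M)
    (hf : ∀ y, (f y).fv ⊆ {y}) :
    A.sat (φ.substAll f) v ↔ A.sat φ (fun y => A.tval (f y) v) := by
  induction φ generalizing f v with
  | all x φ ih | ex x φ ih =>
    simp only [Formula.substAll, Str.sat]
    have key : ∀ a, A.sat (φ.substAll (Function.update f x (Term.var x))) (Function.update v x a) ↔
        A.sat φ (Function.update (fun y => A.tval (f y) v) x a) := by
      intro a
      rw [ih]
      · have : (fun y => A.tval (Function.update f x (Term.var x) y) (Function.update v x a)) =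
            (Function.update (fun y => A.tval (f y) v) x a) := by
          funext y
          by_cases h : y = x
          · subst h; simp [Str.tval]
          · simp only [ne_eq, h, not_false_eq_true, Function.update_of_ne]
            apply A.tval_upd_notin
            intro hx
            have := hf y hx
            rw [Finset.mem_singleton] at this
            exact h this.symm
        rw [this]
      · intro y
        by_cases h : y = x
        · subst h; simp [Term.fv]
        · simpa [h] using hf y
    simp only [key]
  | _ => simp_all [Formula.substAll, Str.sat, A.tval_substAll]

theorem Str.sat_subst (A : Str) (φ : Formula) (x : ℕ) (t : Term) (v : ℕ → A.M)
    (ht : t.fv ⊆ {x}) :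
    A.sat (φ.subst x t) v ↔ A.sat φ (Function.update v x (A.tval t v)) := by
  unfold Formula.subst
  rw [A.sat_substAll]
  · have : (fun y => A.tval (Function.update Term.var x t y) v) =
        Function.update v x (A.tval t v) := by
      funext y
      by_cases h : y = x
      · subst h; simp
      · simp [h, Str.tval]
    rw [this]
  · intro y
    by_cases h : y = x
    · subst h; simpa using ht
    · simp [h, Term.fv]

theorem Term.mx_substAll {K : ℕ} (t : Term) (f : ℕ → Term) (ht : t.mx ≤ K)
    (hf : ∀ y, y < K → (f y).mx ≤ K) : (t.substAll f).mx ≤ K := by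
  induction t with
  | var x => exact hf x ht
  | _ => simp_all [Term.substAll, Term.mx]

theorem Formula.mx_substAll {K : ℕ} (φ : Formula) (f : ℕ → Term) (hφ : φ.mx ≤ K)
    (hf : ∀ y, y < K → (f y).mx ≤ K) : (φ.substAll f).mx ≤ K := by
  induction φ generalizing f with
  | eq t u | le t u =>
    simp only [Formula.mx, max_le_iff] at hφ
    simp only [Formula.substAll, Formula.mx, max_le_iff]
    exact ⟨Term.mx_substAll _ _ hφ.1 hf, Term.mx_substAll _ _ hφ.2 hf⟩
  | all x φ ih | ex x φ ih =>
    simp only [Formula.mx, max_le_iff] at hφ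
    simp only [Formula.substAll, Formula.mx, max_le_iff]
    refine ⟨hφ.1, ih _ hφ.2 ?_⟩
    intro y hy
    by_cases h : y = x
    · subst h; simpa [Term.mx] using hy
    · simpa [h] using hf y hy
  | _ => simp_all [Formula.substAll, Formula.mx]

theorem Formula.mx_subst {K : ℕ} (φ : Formula) (x : ℕ) (t : Term) (hφ : φ.mx ≤ K)
    (ht : t.mx ≤ K) : (φ.subst x t).mx ≤ K := by
  apply Formula.mx_substAll _ _ hφ
  intro y hy
  by_cases h : y = x
  · subst h; simpa using ht
  · simpa [h, Term.mx] using hy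

theorem Term.numeral_fv_s14 (n : ℕ) : (Term.numeral n).fv = ∅ := by
  induction n <;> simp_all [Term.numeral, Term.fv]

theorem Term.numeral_mx (n : ℕ) : (Term.numeral n).mx = 0 := by
  induction n <;> simp_all [Term.numeral, Term.mx]

/-- Standard elements of a structure. -/
def Str.nm (A : Str) : ℕ → A.M
  | 0 => A.z
  | n + 1 => A.s (nm A n)

theorem Str.tval_numeral (A : Str) (n : ℕ) (v : ℕ → A.M) : A.tval (Term.numeral n) v = A.nm n := by
  induction n <;> simp_all [Term.numeral, Str.tval, Str.nm]

theorem Str.sat_subst_numeral (A : Str) (φ : Formula) (x n : ℕ) (v : ℕ → A.M) :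
    A.sat (φ.subst x (Term.numeral n)) v ↔ A.sat φ (Function.update v x (A.nm n)) := by
  rw [A.sat_subst _ _ _ _ (by simp [Term.numeral_fv_s14]), A.tval_numeral]

/-- Models of PA (with induction for formulas with variables below `K`). -/
structure PAModel (K : ℕ) (A : Str) : Prop where
  hK : 3 ≤ K
  s_ne : ∀ a, A.s a ≠ A.z
  s_inj : ∀ {a b}, A.s a = A.s b → a = b
  add_z : ∀ a, A.a a A.z = a
  add_s : ∀ a b, A.a a (A.s b) = A.s (A.a a b)
  mul_z : ∀ a, A.m a A.z = A.z
  mul_s : ∀ a b, A.m a (A.s b) = A.a (A.m a b) a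
  le_iff : ∀ a b, A.le a b ↔ ∃ c, A.a a c = b
  ind : ∀ (x : ℕ) (φ : Formula), x < K → φ.mx ≤ K → ∀ v : ℕ → A.M,
    A.sat φ (Function.update v x A.z) →
    (∀ a, A.sat φ (Function.update v x a) → A.sat φ (Function.update v x (A.s a))) →
    ∀ a, A.sat φ (Function.update v x a)

/-- A valuation with prescribed first three values. -/
def tri {M : Type} (a b c : M) : ℕ → M
  | 0 => a
  | 1 => b
  | _ => c

theorem TModel.paModel {T : Set Formula} (hT : Extends T PABox) {K : ℕ} (hK : 3 ≤ K) {A : Str}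
    (h : TModel T K A) : PAModel K A := by
  have base : ∀ φ ∈ baseAxioms, φ.mx ≤ K → ∀ v, A.sat φ v :=
    fun φ hφ hm v => h φ hm (hT φ (Or.inl hφ)) v
  refine ⟨hK, ?_, ?_, ?_, ?_, ?_, ?_, ?_, ?_⟩
  · intro a
    exact base succNeZero (by simp [baseAxioms]) (by simp [succNeZero, Formula.mx, Term.mx]; omega)
      (tri a a a)
  · intro a b
    exact base succInj (by simp [baseAxioms]) (by simp [succInj, Formula.mx, Term.mx]; omega)
      (tri a b a)
  · intro a
    exact base addZero (by simp [baseAxioms]) (by simp [addZero, Formula.mx, Term.mx]; omega)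
      (tri a a a)
  · intro a b
    exact base addSucc (by simp [baseAxioms]) (by simp [addSucc, Formula.mx, Term.mx]; omega)
      (tri a b a)
  · intro a
    exact base mulZero (by simp [baseAxioms]) (by simp [mulZero, Formula.mx, Term.mx]; omega)
      (tri a a a)
  · intro a b
    exact base mulSucc (by simp [baseAxioms]) (by simp [mulSucc, Formula.mx, Term.mx]; omega)
      (tri a b a)
  · intro a b
    have := base leDef (by simp [baseAxioms])
      (by simp [leDef, Formula.iff, Formula.mx, Term.mx]; omega) (tri a b a)
    simp [leDef, Formula.iff, Str.sat, Str.tval, Function.update, tri] at this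
    constructor
    · exact this.1
    · rintro ⟨c, hc⟩; exact this.2 c hc
  · intro x φ hx hφ v h0 hs
    have hax : Provable T (inductionAx x φ) := hT _ (Or.inr ⟨x, φ, rfl⟩)
    have := h _ (by
      simp only [inductionAx, Formula.mx, max_le_iff]
      exact ⟨⟨Formula.mx_subst _ _ _ hφ (by simp [Term.mx]), hx, hφ,
        Formula.mx_subst _ _ _ hφ (by simpa [Term.mx] using hx)⟩, hx, hφ⟩) hax v
    simp only [inductionAx, Str.sat] at this
    apply this
    refine ⟨?_, ?_⟩
    · rw [A.sat_subst _ _ _ _ (by simp [Term.fv])]; exact h0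
    · intro a ha
      rw [A.sat_subst _ _ _ _ (by simp [Term.fv])]
      simpa [Str.tval] using hs a ha

/-- The standard structure. -/
abbrev Nst : Str := ⟨ℕ, 0, fun n => n + 1, fun a b => a + b, fun a b => a * b, fun a b => a ≤ b⟩

theorem Nst_nm (n : ℕ) : Nst.nm n = n := by
  induction n with
  | zero => rfl
  | succ n ih => simp only [Str.nm, ih]

theorem Nst_pa {K : ℕ} (hK : 3 ≤ K) : PAModel K Nst where
  hK := hK
  s_ne := fun a => Nat.succ_ne_zero a
  s_inj := fun h => Nat.succ.inj h
  add_z := fun a => Nat.add_zero a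
  add_s := fun _ _ => rfl
  mul_z := fun a => Nat.mul_zero a
  mul_s := fun _ _ => rfl
  le_iff := by
    intro (a : ℕ) (b : ℕ)
    show a ≤ b ↔ ∃ c : ℕ, a + c = b
    exact ⟨fun h => ⟨b - a, by omega⟩, fun ⟨c, hc⟩ => by omega⟩
  ind := by
    intro x φ _ _ v h0 hs a
    exact Nat.rec (motive := fun n : ℕ => Nst.sat φ (Function.update v x n)) h0 hs a

section PA

variable {K : ℕ} {A : Str}

theorem PAModel.cases (h : PAModel K A) (a : A.M) : a = A.z ∨ ∃ b, a = A.s b := by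
  have hK := h.hK
  have := h.ind 0 (.or (.eq (.var 0) .zero) (.ex 1 (.eq (.var 0) (.succ (.var 1))))) (by omega)
    (by simp [Formula.mx, Term.mx]; omega) (fun _ => A.z)
    (by simp [Str.sat, Str.tval]) (fun a _ => Or.inr ⟨a, by simp [Str.sat, Str.tval]⟩) a
  simpa [Str.sat, Str.tval, Function.update] using this

theorem PAModel.z_add (h : PAModel K A) (a : A.M) : A.a A.z a = a := by
  have hK := h.hK
  have := h.ind 0 (.eq (.add .zero (.var 0)) (.var 0)) (by omega)
    (by simp [Formula.mx, Term.mx]; omega) (fun _ => A.z)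
    (by simp [Str.sat, Str.tval, h.add_z])
    (fun a ha => by simp_all [Str.sat, Str.tval, h.add_s]) a
  simpa [Str.sat, Str.tval] using this

theorem PAModel.s_add (h : PAModel K A) (a b : A.M) : A.a (A.s a) b = A.s (A.a a b) := by
  have hK := h.hK
  have := h.ind 1 (.eq (.add (.succ (.var 0)) (.var 1)) (.succ (.add (.var 0) (.var 1))))
    (by omega) (by simp [Formula.mx, Term.mx]; omega) (fun _ => a)
    (by simp [Str.sat, Str.tval, h.add_z])
    (fun a ha => by simp_all [Str.sat, Str.tval, h.add_s]) b
  simpa [Str.sat, Str.tval] using this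

theorem PAModel.add_comm (h : PAModel K A) (a b : A.M) : A.a a b = A.a b a := by
  have hK := h.hK
  have := h.ind 1 (.eq (.add (.var 0) (.var 1)) (.add (.var 1) (.var 0)))
    (by omega) (by simp [Formula.mx, Term.mx]; omega) (fun _ => a)
    (by simp [Str.sat, Str.tval, h.add_z, h.z_add])
    (fun a ha => by simp_all [Str.sat, Str.tval, h.add_s, h.s_add]) b
  simpa [Str.sat, Str.tval] using this

theorem PAModel.add_assoc (h : PAModel K A) (a b c : A.M) : A.a (A.a a b) c = A.a a (A.a b c) := by
  have hK := h.hK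
  have := h.ind 2 (.eq (.add (.add (.var 0) (.var 1)) (.var 2))
      (.add (.var 0) (.add (.var 1) (.var 2))))
    (by omega) (by simp [Formula.mx, Term.mx]; omega) (tri a b a)
    (by simp [Str.sat, Str.tval, h.add_z])
    (fun a ha => by simp_all [Str.sat, Str.tval, h.add_s]) c
  simpa [Str.sat, Str.tval, tri] using this

theorem PAModel.le_refl (h : PAModel K A) (a : A.M) : A.le a a :=
  (h.le_iff a a).2 ⟨A.z, h.add_z a⟩

theorem PAModel.le_trans (h : PAModel K A) {a b c : A.M} (h1 : A.le a b) (h2 : A.le b c) :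
    A.le a c := by
  obtain ⟨d, rfl⟩ := (h.le_iff _ _).1 h1
  obtain ⟨e, rfl⟩ := (h.le_iff _ _).1 h2
  exact (h.le_iff _ _).2 ⟨A.a d e, (h.add_assoc _ _ _).symm⟩

theorem PAModel.le_add (h : PAModel K A) (a b : A.M) : A.le a (A.a a b) :=
  (h.le_iff _ _).2 ⟨b, rfl⟩

theorem PAModel.le_add' (h : PAModel K A) (a b : A.M) : A.le a (A.a b a) :=
  h.add_comm a b ▸ h.le_add a b

theorem PAModel.le_s (h : PAModel K A) (a : A.M) : A.le a (A.s a) :=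
  (h.le_iff _ _).2 ⟨A.s A.z, by rw [h.add_s, h.add_z]⟩

theorem PAModel.z_le (h : PAModel K A) (a : A.M) : A.le A.z a :=
  (h.le_iff _ _).2 ⟨a, h.z_add a⟩

theorem PAModel.not_s_le_z (h : PAModel K A) (a : A.M) : ¬ A.le (A.s a) A.z := by
  intro hl
  obtain ⟨c, hc⟩ := (h.le_iff _ _).1 hl
  rw [h.s_add] at hc
  exact h.s_ne _ hc

theorem PAModel.s_le_s (h : PAModel K A) {a b : A.M} : A.le (A.s a) (A.s b) ↔ A.le a b := by
  rw [h.le_iff, h.le_iff]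
  constructor
  · rintro ⟨c, hc⟩
    rw [h.s_add] at hc
    exact ⟨c, h.s_inj hc⟩
  · rintro ⟨c, rfl⟩
    exact ⟨c, h.s_add _ _⟩

theorem PAModel.lt_or_eq (h : PAModel K A) {a b : A.M} (hl : A.le a b) :
    A.le (A.s a) b ∨ a = b := by
  obtain ⟨c, rfl⟩ := (h.le_iff _ _).1 hl
  rcases h.cases c with rfl | ⟨d, rfl⟩
  · right; rw [h.add_z]
  · left; exact (h.le_iff _ _).2 ⟨d, by rw [h.s_add, h.add_s]⟩

theorem PAModel.total (h : PAModel K A) (a b : A.M) : A.le a b ∨ A.le (A.s b) a := by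
  have hK := h.hK
  have := h.ind 0 (.or (.le (.var 0) (.var 1)) (.le (.succ (.var 1)) (.var 0)))
    (by omega) (by simp [Formula.mx, Term.mx]; omega) (fun _ => b)
    (by simp [Str.sat, Str.tval, h.z_le])
    (fun a ha => by
      simp only [Str.sat, Str.tval, Function.update_self, ne_eq, one_ne_zero, not_false_eq_true,
        Function.update_of_ne] at ha ⊢
      rcases ha with ha | ha
      · rcases h.lt_or_eq ha with h1 | rfl
        · exact Or.inl h1
        · exact Or.inr (h.le_refl _)
      · exact Or.inr (h.le_trans ha (h.le_s _))) a
  simpa [Str.sat, Str.tval, tri] using this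

theorem PAModel.nm_add (h : PAModel K A) (m n : ℕ) : A.nm (m + n) = A.a (A.nm m) (A.nm n) := by
  induction n with
  | zero => exact (h.add_z _).symm
  | succ n ih => rw [← Nat.add_assoc, Str.nm, ih, Str.nm, h.add_s]

theorem PAModel.nm_mul (h : PAModel K A) (m n : ℕ) : A.nm (m * n) = A.m (A.nm m) (A.nm n) := by
  induction n with
  | zero => exact (h.mul_z _).symm
  | succ n ih => rw [Nat.mul_succ, h.nm_add, ih, Str.nm, h.mul_s]

theorem PAModel.le_nm (h : PAModel K A) {a : A.M} {n : ℕ} (hl : A.le a (A.nm n)) :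
    ∃ k, k ≤ n ∧ a = A.nm k := by
  induction n generalizing a with
  | zero =>
    rcases h.cases a with rfl | ⟨b, rfl⟩
    · exact ⟨0, le_rfl, rfl⟩
    · exact (h.not_s_le_z _ hl).elim
  | succ n ih =>
    rcases h.cases a with rfl | ⟨b, rfl⟩
    · exact ⟨0, by omega, rfl⟩
    · obtain ⟨k, hk, rfl⟩ := ih (h.s_le_s.1 hl)
      exact ⟨k + 1, by omega, rfl⟩

theorem PAModel.nm_inj (h : PAModel K A) : ∀ {m n : ℕ}, A.nm m = A.nm n → m = n
  | 0, 0, _ => rfl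
  | 0, n + 1, e => (h.s_ne _ e.symm).elim
  | m + 1, 0, e => (h.s_ne _ e).elim
  | m + 1, n + 1, e => by rw [h.nm_inj (h.s_inj e)]

theorem PAModel.nm_le (h : PAModel K A) {m n : ℕ} : A.le (A.nm m) (A.nm n) ↔ m ≤ n := by
  constructor
  · intro hl
    obtain ⟨k, hk, e⟩ := h.le_nm hl
    rw [h.nm_inj e]; exact hk
  · intro hl
    obtain ⟨k, rfl⟩ := Nat.exists_eq_add_of_le hl
    rw [h.nm_add]; exact h.le_add _ _

theorem PAModel.tval_nm (h : PAModel K A) (t : Term) (v : ℕ → ℕ) :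
    A.tval t (fun x => A.nm (v x)) = A.nm (Nst.tval t v) := by
  induction t with
  | var x => rfl
  | zero => rfl
  | succ t ih => simp only [Str.tval, ih]; rfl
  | add t u ih1 ih2 => simp only [Str.tval, ih1, ih2]; exact (h.nm_add _ _).symm
  | mul t u ih1 ih2 => simp only [Str.tval, ih1, ih2]; exact (h.nm_mul _ _).symm

theorem upd_nm (A : Str) (v : ℕ → ℕ) (x n : ℕ) :
    Function.update (fun x => A.nm (v x)) x (A.nm n) = fun y => A.nm (Function.update v x n y) := by
  funext y
  by_cases h : y = x
  · subst h; simp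
  · simp [h]

theorem Str.sat_ball (A : Str) {x : ℕ} {t : Term} (hx : x ∉ t.fv) (φ : Formula) (v : ℕ → A.M) :
    A.sat (.ball x t φ) v ↔
      ∀ a, A.le (A.s a) (A.tval t v) → A.sat φ (Function.update v x a) := by
  simp only [Formula.ball, Formula.lt, Str.sat, Str.tval, Function.update_self,
    A.tval_upd_notin hx]

theorem Str.sat_bex (A : Str) {x : ℕ} {t : Term} (hx : x ∉ t.fv) (φ : Formula) (v : ℕ → A.M) :
    A.sat (.bex x t φ) v ↔
      ∃ a, A.le (A.s a) (A.tval t v) ∧ A.sat φ (Function.update v x a) := by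
  simp only [Formula.bex, Formula.lt, Str.sat, Str.tval, Function.update_self,
    A.tval_upd_notin hx]

theorem PAModel.s_le_nm (h : PAModel K A) {a : A.M} {n : ℕ} :
    A.le (A.s a) (A.nm n) ↔ ∃ k, k < n ∧ a = A.nm k := by
  constructor
  · intro hl
    obtain ⟨k, hk, e⟩ := h.le_nm hl
    cases k with
    | zero => exact (h.s_ne _ e).elim
    | succ k => exact ⟨k, hk, h.s_inj e⟩
  · rintro ⟨k, hk, rfl⟩
    exact (h.nm_le (m := k + 1)).2 hk

/-- Absoluteness of Δ₀ formulas. -/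
theorem PAModel.delta0 (h : PAModel K A) {φ : Formula} (hφ : IsDelta0 φ) (v : ℕ → ℕ) :
    A.sat φ (fun x => A.nm (v x)) ↔ Nst.sat φ v := by
  induction hφ generalizing v with
  | falsum => rfl
  | eq t u =>
    simp only [Str.sat, h.tval_nm]
    exact ⟨fun e => h.nm_inj e, fun e => by rw [e]⟩
  | le t u =>
    simp only [Str.sat, h.tval_nm]
    exact h.nm_le
  | and _ _ ih1 ih2 | or _ _ ih1 ih2 | imp _ _ ih1 ih2 => simp only [Str.sat, ih1, ih2]
  | neg _ ih => simp only [Str.sat, ih]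
  | ball hx _ ih =>
    rw [A.sat_ball hx, Nst.sat_ball hx, h.tval_nm]
    constructor
    · intro hh a ha
      rw [← ih, ← upd_nm]
      exact hh _ (h.s_le_nm.2 ⟨a, ha, rfl⟩)
    · intro hh a ha
      obtain ⟨k, hk, rfl⟩ := h.s_le_nm.1 ha
      rw [upd_nm, ih]
      exact hh k hk
  | bex hx _ ih =>
    rw [A.sat_bex hx, Nst.sat_bex hx, h.tval_nm]
    constructor
    · rintro ⟨a, ha, hh⟩
      obtain ⟨k, hk, rfl⟩ := h.s_le_nm.1 ha
      rw [upd_nm, ih] at hh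
      exact ⟨k, hk, hh⟩
    · rintro ⟨a, ha, hh⟩
      refine ⟨A.nm a, h.s_le_nm.2 ⟨a, ha, rfl⟩, ?_⟩
      rw [upd_nm, ih]; exact hh

/-- Upward absoluteness of ΣB formulas. -/
theorem PAModel.sigmaB (h : PAModel K A) {φ : Formula} (hφ : IsSigmaB φ) (v : ℕ → ℕ)
    (hs : Nst.sat φ v) : A.sat φ (fun x => A.nm (v x)) := by
  have ballc : ∀ {x : ℕ} {t : Term} {φ : Formula}, x ∉ t.fv →
      (∀ v : ℕ → ℕ, Nst.sat φ v → A.sat φ (fun x => A.nm (v x))) → ∀ v : ℕ → ℕ,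
      Nst.sat (.ball x t φ) v → A.sat (.ball x t φ) (fun x => A.nm (v x)) := by
    intro x t φ hx ih v hs
    rw [Nst.sat_ball hx] at hs
    rw [A.sat_ball hx, h.tval_nm]
    intro a ha
    obtain ⟨k, hk, rfl⟩ := h.s_le_nm.1 ha
    rw [upd_nm]
    exact ih _ (hs k hk)
  have exc : ∀ {x : ℕ} {φ : Formula},
      (∀ v : ℕ → ℕ, Nst.sat φ v → A.sat φ (fun x => A.nm (v x))) → ∀ v : ℕ → ℕ,
      Nst.sat (.ex x φ) v → A.sat (.ex x φ) (fun x => A.nm (v x)) := by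
    rintro x φ ih v ⟨n, hn⟩
    refine ⟨A.nm n, ?_⟩
    rw [upd_nm]
    exact ih _ hn
  have sg : ∀ {φ : Formula}, IsSigma1 φ → ∀ v : ℕ → ℕ, Nst.sat φ v →
      A.sat φ (fun x => A.nm (v x)) := by
    intro φ hφ
    induction hφ with
    | delta0 hd => exact fun v hv => (h.delta0 hd v).2 hv
    | and _ _ ih1 ih2 => exact fun v hv => ⟨ih1 v hv.1, ih2 v hv.2⟩
    | or _ _ ih1 ih2 => exact fun v hv => hv.imp (ih1 v) (ih2 v)
    | ex _ ih => exact exc ih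
    | ball hx _ ih => exact ballc hx ih
  induction hφ generalizing v with
  | sigma1 h1 => exact sg h1 v hs
  | b ψ => trivial
  | and _ _ ih1 ih2 => exact ⟨ih1 v hs.1, ih2 v hs.2⟩
  | or _ _ ih1 ih2 => exact hs.imp (ih1 v) (ih2 v)
  | ex _ ih => exact exc (fun v => ih v) v hs
  | ball hx _ ih => exact ballc hx (fun v => ih v) v hs

end PA

theorem val_tval (t : Term) (v : ℕ → ℕ) : t.val v = Nst.tval t v := by
  induction t <;> simp_all [Term.val, Str.tval]

theorem IsDelta0.noBox {φ : Formula} (h : IsDelta0 φ) : φ.noBox := by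
  induction h <;> simp_all [Formula.noBox, Formula.ball, Formula.bex, Formula.lt]

theorem IsSigma1.noBox {φ : Formula} (h : IsSigma1 φ) : φ.noBox := by
  induction h with
  | delta0 h => exact h.noBox
  | _ => simp_all [Formula.noBox, Formula.ball, Formula.lt]

theorem val_sat {φ : Formula} (h : φ.noBox) (v : ℕ → ℕ) : φ.val v ↔ Nst.sat φ v := by
  induction φ generalizing v with
  | falsum => rfl
  | eq t u => simp only [Formula.val, Str.sat, val_tval]
  | le t u => simp only [Formula.val, Str.sat, val_tval]
  | and φ ψ ih1 ih2 | or φ ψ ih1 ih2 | imp φ ψ ih1 ih2 =>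
    simp only [Formula.val, Str.sat, ih1 h.1, ih2 h.2]
  | neg φ ih => simp only [Formula.val, Str.sat, ih h]
  | all x φ ih => exact forall_congr' fun n => ih h _
  | ex x φ ih => exact exists_congr fun n => ih h _
  | box φ => exact h.elim


/-! ### Bounding Σ₁ formulas -/

theorem PAModel.delta0' {K : ℕ} {A : Str} (h : PAModel K A) {φ : Formula} (hφ : IsDelta0 φ)
    {v : ℕ → A.M} {w : ℕ → ℕ} (hv : ∀ y ∈ φ.fv, v y = A.nm (w y)) :
    A.sat φ v ↔ Nst.sat φ w := by
  rw [← h.delta0 hφ]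
  exact A.sat_congr hv

theorem PAModel.sigmaB' {K : ℕ} {A : Str} (h : PAModel K A) {φ : Formula} (hφ : IsSigmaB φ)
    {v : ℕ → A.M} {w : ℕ → ℕ} (hv : ∀ y ∈ φ.fv, v y = A.nm (w y)) (hs : Nst.sat φ w) :
    A.sat φ v :=
  (A.sat_congr hv).2 (h.sigmaB hφ w hs)

theorem notin_fv_of_mx {φ : Formula} {N z : ℕ} (h : φ.mx ≤ N) (hz : N ≤ z) : z ∉ φ.fv :=
  fun hh => by have := Formula.lt_mx hh; omega

/-- `φ'` is a Δ₀ bounded version of `φ` with bound variable `z`. -/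
structure Bnd (K z : ℕ) (φ φ' : Formula) : Prop where
  d0 : IsDelta0 φ'
  mx : φ'.mx ≤ K
  fv : φ'.fv ⊆ insert z φ.fv
  mono : ∀ A : Str, PAModel K A → ∀ (v : ℕ → A.M) (a b : A.M), A.le a b →
    A.sat φ' (Function.update v z a) → A.sat φ' (Function.update v z b)
  equiv : ∀ A : Str, PAModel K A → ∀ v : ℕ → A.M,
    A.sat φ v ↔ ∃ a, A.sat φ' (Function.update v z a)

theorem sigma1_bound {φ : Formula} (hφ : IsSigma1 φ) {N z u K : ℕ} (hN : φ.mx ≤ N) (hz : N ≤ z)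
    (hu : N ≤ u) (hzu : z ≠ u) (hzK : z < K) (huK : u < K) : ∃ φ', Bnd K z φ φ' := by
  induction hφ with
  | @delta0 φ hd =>
    have hzf := notin_fv_of_mx hN hz
    refine ⟨φ, hd, by omega, Finset.subset_insert _ _, ?_, ?_⟩
    · intro A _ v a b _ hs
      rw [A.sat_upd_notin hzf] at hs ⊢; exact hs
    · intro A _ v
      simp only [A.sat_upd_notin hzf]
      exact ⟨fun h => ⟨A.z, h⟩, fun ⟨_, h⟩ => h⟩
  | @and φ ψ _ _ ih1 ih2 =>
    simp only [Formula.mx, max_le_iff] at hN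
    obtain ⟨φ', b1⟩ := ih1 hN.1
    obtain ⟨ψ', b2⟩ := ih2 hN.2
    refine ⟨φ'.and ψ', b1.d0.and b2.d0, by simp [Formula.mx, b1.mx, b2.mx], ?_, ?_, ?_⟩
    · have h1 := b1.fv
      have h2 := b2.fv
      intro y hy
      simp only [Formula.fv, Finset.mem_union, Finset.mem_insert] at hy ⊢
      have h1 := @h1 y
      have h2 := @h2 y
      simp only [Finset.mem_insert] at h1 h2
      tauto
    · intro A hA v a b hab hs
      exact ⟨b1.mono A hA v a b hab hs.1, b2.mono A hA v a b hab hs.2⟩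
    · intro A hA v
      simp only [Str.sat, b1.equiv A hA, b2.equiv A hA]
      constructor
      · rintro ⟨⟨a, ha⟩, ⟨b, hb⟩⟩
        exact ⟨A.a a b, b1.mono A hA v _ _ (hA.le_add _ _) ha, b2.mono A hA v _ _ (hA.le_add' _ _) hb⟩
      · rintro ⟨a, ha, hb⟩
        exact ⟨⟨a, ha⟩, ⟨a, hb⟩⟩
  | @or φ ψ _ _ ih1 ih2 =>
    simp only [Formula.mx, max_le_iff] at hN
    obtain ⟨φ', b1⟩ := ih1 hN.1
    obtain ⟨ψ', b2⟩ := ih2 hN.2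
    refine ⟨φ'.or ψ', b1.d0.or b2.d0, by simp [Formula.mx, b1.mx, b2.mx], ?_, ?_, ?_⟩
    · have h1 := b1.fv
      have h2 := b2.fv
      intro y hy
      simp only [Formula.fv, Finset.mem_union, Finset.mem_insert] at hy ⊢
      have h1 := @h1 y
      have h2 := @h2 y
      simp only [Finset.mem_insert] at h1 h2
      tauto
    · intro A hA v a b hab hs
      exact hs.imp (b1.mono A hA v a b hab) (b2.mono A hA v a b hab)
    · intro A hA v
      simp only [Str.sat, b1.equiv A hA, b2.equiv A hA, exists_or]
  | @ex x φ _ ih =>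
    simp only [Formula.mx, max_le_iff] at hN
    obtain ⟨φ', b⟩ := ih hN.2
    have hxz : x ≠ z := by omega
    have hxf : x ∉ (Term.var z).fv := by simpa [Term.fv] using hxz
    refine ⟨.bex x (.var z) φ', .bex hxf b.d0, ?_, ?_, ?_, ?_⟩
    · simp only [Formula.bex, Formula.lt, Formula.mx, Term.mx, max_le_iff]
      have := b.mx
      omega
    · intro y hy
      have h1 := @b.fv y
      simp only [Formula.bex, Formula.lt, Formula.fv, Term.fv, Finset.mem_union, Finset.mem_insert,
        Finset.mem_erase, Finset.mem_singleton] at hy h1 ⊢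
      tauto
    · intro A hA v a c hac hs
      rw [A.sat_bex hxf] at hs ⊢
      obtain ⟨d, hd, hs⟩ := hs
      rw [Function.update_comm hxz.symm] at hs
      refine ⟨d, ?_, ?_⟩
      · simp only [Str.tval, Function.update_self] at hd ⊢
        exact hA.le_trans hd hac
      · rw [Function.update_comm hxz.symm]
        exact b.mono A hA _ _ _ hac hs
    · intro A hA v
      simp only [A.sat_bex hxf]
      simp only [Str.sat, b.equiv A hA, Str.tval, Function.update_self]
      constructor
      · rintro ⟨c, a, ha⟩
        refine ⟨A.a (A.s c) a, c, hA.le_add _ _, ?_⟩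
        rw [Function.update_comm hxz.symm]
        exact b.mono A hA _ _ _ (hA.le_add' _ _) ha
      · rintro ⟨a, c, _, ha⟩
        rw [Function.update_comm hxz.symm] at ha
        exact ⟨c, a, ha⟩
  | @ball x t φ hx _ ih =>
    simp only [Formula.ball, Formula.lt, Formula.mx, Term.mx, max_le_iff] at hN
    obtain ⟨φ', b⟩ := ih hN.2.2
    have hxz : x ≠ z := by omega
    have hxu : x ≠ u := by omega
    have hzt : z ∉ t.fv := by
      intro hh
      have : z < t.mx := Term.lt_mx hh
      omega
    have hut : u ∉ t.fv := by
      intro hh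
      have : u < t.mx := Term.lt_mx hh
      omega
    have huf : u ∉ φ'.fv := by
      intro hh
      have h1 := b.fv hh
      rw [Finset.mem_insert] at h1
      rcases h1 with h1 | h1
      · exact hzu h1.symm
      · exact notin_fv_of_mx hN.2.2 hu h1
    refine ⟨.ball x t φ', .ball hx b.d0, ?_, ?_, ?_, ?_⟩
    · simp only [Formula.ball, Formula.lt, Formula.mx, Term.mx, max_le_iff]
      have := b.mx
      omega
    · intro y hy
      have h1 := @b.fv y
      simp only [Formula.ball, Formula.lt, Formula.fv, Term.fv, Finset.mem_union, Finset.mem_insert,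
        Finset.mem_erase, Finset.mem_singleton] at hy h1 ⊢
      tauto
    · intro A hA v a c hac hs
      rw [A.sat_ball hx, A.tval_upd_notin hzt] at hs ⊢
      intro d hd
      have := hs d hd
      rw [Function.update_comm hxz.symm] at this ⊢
      exact b.mono A hA _ _ _ hac this
    · intro A hA v
      simp only [A.sat_ball hx, A.tval_upd_notin hzt]
      constructor
      · intro hh
        have key := hA.ind u (.imp (.le (.var u) t) (.ex z (.ball x (.var u) φ'))) huK (by
          simp only [Formula.ball, Formula.lt, Formula.mx, Term.mx, max_le_iff]
          have := b.mx
          omega) v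
        have hxu' : x ∉ (Term.var u).fv := by simpa [Term.fv] using hxu
        have e : ∀ d, A.sat (.imp (.le (.var u) t) (.ex z (.ball x (.var u) φ')))
            (Function.update v u d) ↔ (A.le d (A.tval t v) → ∃ a, ∀ c, A.le (A.s c) d →
              A.sat φ' (Function.update (Function.update v x c) z a)) := by
          intro d
          have e1 : ∀ c a, A.sat φ' (Function.update (Function.update (Function.update v u d) z a) x c)
              ↔ A.sat φ' (Function.update (Function.update v x c) z a) := by
            intro c a
            rw [Function.update_comm hzu.symm, Function.update_comm hxu.symm, A.sat_upd_notin huf,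
              Function.update_comm hxz.symm]
          simp only [Str.sat.eq_6, Str.sat.eq_9, Str.sat.eq_3]
          simp only [A.sat_ball hxu', e1, A.tval_upd_notin hut]
          simp [Str.tval, hzu.symm]
        simp only [e] at key
        refine (key ?_ ?_ (A.tval t v) (hA.le_refl _)).imp ?_
        · intro _
          exact ⟨A.z, fun c hc => (hA.not_s_le_z _ hc).elim⟩
        · intro d ih hd
          obtain ⟨a, ha⟩ := ih (hA.le_trans (hA.le_s _) hd)
          obtain ⟨a', ha'⟩ := (b.equiv A hA _).1 (hh d hd)
          refine ⟨A.a a a', fun c hc => ?_⟩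
          rcases hA.lt_or_eq (hA.s_le_s.1 hc) with h1 | rfl
          · exact b.mono A hA _ _ _ (hA.le_add _ _) (ha c h1)
          · exact b.mono A hA _ _ _ (hA.le_add' _ _) ha'
        · intro a ha c hc
          rw [Function.update_comm hxz.symm]
          exact ha c hc
      · rintro ⟨a, ha⟩ c hc
        rw [b.equiv A hA]
        refine ⟨a, ?_⟩
        rw [Function.update_comm hxz]
        exact ha c hc

/-- Least number principle. -/
theorem PAModel.lnp {K : ℕ} {A : Str} (h : PAModel K A) {φ : Formula} {z u : ℕ} (hφ : φ.mx ≤ K)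
    (hz : z < K) (hu : u < K) (hzu : z ≠ u) (huf : u ∉ φ.fv) (v : ℕ → A.M)
    (he : ∃ a, A.sat φ (Function.update v z a)) :
    ∃ a, A.sat φ (Function.update v z a) ∧
      ∀ b, A.le (A.s b) a → ¬ A.sat φ (Function.update v z b) := by
  by_contra hno
  push Not at hno
  have hzu' : z ∉ (Term.var u).fv := by simpa [Term.fv] using hzu
  have key := h.ind u (.ball z (.var u) (.neg φ)) hu (by
    simp only [Formula.ball, Formula.lt, Formula.mx, Term.mx, max_le_iff]
    omega) v
  have e : ∀ d, A.sat (.ball z (.var u) (.neg φ)) (Function.update v u d) ↔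
      ∀ b, A.le (A.s b) d → ¬ A.sat φ (Function.update v z b) := by
    intro d
    rw [A.sat_ball hzu']
    simp only [Str.sat, Str.tval, Function.update_self]
    simp only [Function.update_comm hzu.symm, A.sat_upd_notin huf]
  simp only [e] at key
  have key := key (fun b hb => (h.not_s_le_z _ hb).elim) (by
    intro a ih b hb hs
    rcases h.lt_or_eq (h.s_le_s.1 hb) with h1 | rfl
    · exact ih b h1 hs
    · obtain ⟨c, hc, hc'⟩ := hno b hs
      exact ih c hc hc')
  obtain ⟨a, ha⟩ := he
  exact key (A.s a) a (h.le_refl _) ha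

/-- `∀ a < t, χ[z := a]`, using the auxiliary variable `u` (`z` may occur in `t`). -/
def allBelow (u z : ℕ) (t : Term) (χ : Formula) : Formula :=
  .ball u t (.bex z (.succ (.var u)) (.and (.eq (.var z) (.var u)) χ))

theorem Str.sat_allBelow {K : ℕ} {A : Str} (h : PAModel K A) {u z : ℕ} {t : Term} {χ : Formula}
    (hzu : z ≠ u) (hut : u ∉ t.fv) (huf : u ∉ χ.fv) (v : ℕ → A.M) :
    A.sat (allBelow u z t χ) v ↔
      ∀ a, A.le (A.s a) (A.tval t v) → A.sat χ (Function.update v z a) := by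
  have hz : z ∉ (Term.var u).succ.fv := by simpa [Term.fv] using hzu
  unfold allBelow
  rw [A.sat_ball hut]
  apply forall_congr'
  intro a
  apply imp_congr_right
  intro _
  rw [A.sat_bex hz]
  simp only [Str.sat, Str.tval, Function.update_self, Function.update_of_ne hzu.symm]
  constructor
  · rintro ⟨b, _, rfl, hs⟩
    rw [Function.update_comm hzu.symm, A.sat_upd_notin huf] at hs
    exact hs
  · intro hs
    refine ⟨a, h.le_refl _, rfl, ?_⟩
    rw [Function.update_comm hzu.symm, A.sat_upd_notin huf]
    exact hs

theorem IsDelta0.allBelow {u z : ℕ} {t : Term} {χ : Formula} (hzu : z ≠ u) (hut : u ∉ t.fv)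
    (hχ : IsDelta0 χ) : IsDelta0 (allBelow u z t χ) :=
  .ball hut (.bex (by simpa [Term.fv] using hzu) (.and (.eq _ _) hχ))

theorem allBelow_mx {K u z : ℕ} {t : Term} {χ : Formula} (hu : u < K) (hz : z < K) (ht : t.mx ≤ K)
    (hχ : χ.mx ≤ K) : (allBelow u z t χ).mx ≤ K := by
  simp only [allBelow, Formula.ball, Formula.bex, Formula.lt, Formula.mx, Term.mx, max_le_iff]
  omega

theorem allBelow_fv {u z : ℕ} {t : Term} {χ : Formula} :
    (allBelow u z t χ).fv ⊆ t.fv ∪ χ.fv.erase z := by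
  intro y
  simp only [allBelow, Formula.ball, Formula.bex, Formula.lt, Formula.fv, Term.fv, Finset.mem_union,
    Finset.mem_erase, Finset.mem_singleton]
  tauto

/-! ### Transfer lemmas and the easy implications -/

/-- Replace every boxed formula by a true equation. -/
def Formula.unbox : Formula → Formula
  | .falsum => .falsum
  | .eq t u => .eq t u
  | .le t u => .le t u
  | .and φ ψ => .and (unbox φ) (unbox ψ)
  | .or φ ψ => .or (unbox φ) (unbox ψ)
  | .imp φ ψ => .imp (unbox φ) (unbox ψ)
  | .neg φ => .neg (unbox φ)
  | .all x φ => .all x (unbox φ)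
  | .ex x φ => .ex x (unbox φ)
  | .box _ => .eq .zero .zero

theorem Str.sat_unbox (A : Str) (φ : Formula) (v : ℕ → A.M) : A.sat φ.unbox v ↔ A.sat φ v := by
  induction φ generalizing v <;> simp_all [Formula.unbox, Str.sat]

theorem Formula.unbox_fv (φ : Formula) : φ.unbox.fv ⊆ φ.fv := by
  induction φ with
  | and φ ψ ih1 ih2 | or φ ψ ih1 ih2 | imp φ ψ ih1 ih2 => exact Finset.union_subset_union ih1 ih2
  | neg φ ih => exact ih
  | all x φ ih | ex x φ ih => exact Finset.erase_subset_erase _ ih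
  | box φ => simp [Formula.unbox, Formula.fv, Term.fv]
  | _ => simp [Formula.unbox]

theorem Formula.unbox_noBox {φ : Formula} (h : φ.noBox) : φ.unbox = φ := by
  induction φ <;> simp_all [Formula.unbox, Formula.noBox]

theorem IsSigmaB.unbox {φ : Formula} (h : IsSigmaB φ) : IsSigma1 φ.unbox := by
  induction h with
  | sigma1 h => rw [Formula.unbox_noBox h.noBox]; exact h
  | b ψ => exact .delta0 (.eq _ _)
  | and _ _ ih1 ih2 => exact ih1.and ih2
  | or _ _ ih1 ih2 => exact ih1.or ih2
  | ex _ ih => exact ih.ex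
  | ball hx _ ih => exact IsSigma1.ball hx ih

theorem IsDeltaB.sigmaB {φ : Formula} (h : IsDeltaB φ) : IsSigmaB φ := by
  induction h with
  | delta0 h => exact .sigma1 (.delta0 h)
  | b ψ => exact .b ψ
  | and _ _ ih1 ih2 => exact ih1.and ih2
  | or _ _ ih1 ih2 => exact ih1.or ih2
  | ball hx _ ih => exact IsSigmaB.ball hx ih
  | bex hx _ ih => exact IsSigmaB.ex (.and (.sigma1 (.delta0 (.le _ _))) ih)

section Transfer

variable {T : Set Formula}

theorem hbox_of (hT : Extends T PAVer) (ψ : Formula) : Provable T (.box ψ) := by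
  have h1 : Provable T (.box .falsum) := hT _ (Or.inr rfl)
  have h2 : Provable T (axK .falsum ψ) := hT _ (Or.inl (Or.inr ⟨_, _, rfl⟩))
  exact (h2.mp (Provable.nec (.logic (.falsumE ψ)))).mp h1

theorem paBox_of (hT : Extends T PAVer) : Extends T PABox :=
  fun φ hφ => hT φ (Or.inl (Or.inl hφ))

theorem exists_model (hT : Extends T PAVer) (hcon : Consistent T) {K : ℕ} (hK : 3 ≤ K) :
    ∃ A, TModel T K A ∧ PAModel K A := by
  by_contra hno
  push Not at hno
  apply hcon
  apply completeness (hbox_of hT) K .falsum (by simp [Formula.mx]) (by simp [Sentence, Formula.fv])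
  intro A hA
  exact (hno A hA (hA.paModel (paBox_of hT) hK)).elim

theorem prov_of_models (hT : Extends T PAVer) {K : ℕ} (hK : 3 ≤ K) {φ : Formula} (hφ : φ.mx ≤ K)
    (hs : Sentence φ) (h : ∀ A, TModel T K A → PAModel K A → ∀ v, A.sat φ v) : Provable T φ :=
  completeness (hbox_of hT) K φ hφ hs fun A hA => h A hA (hA.paModel (paBox_of hT) hK)

theorem true_prov (hT : Extends T PAVer) {φ : Formula} (hφ : IsSigmaB φ) (hs : Sentence φ)
    {w : ℕ → ℕ} (h : Nst.sat φ w) : Provable T φ := by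
  apply prov_of_models hT (K := φ.mx + 3) (by omega) (by omega) hs
  intro A _ hA v
  exact hA.sigmaB' hφ (fun y hy => by rw [hs] at hy; simp at hy) h

theorem sound_true (hT : Extends T PAVer) (h1 : Sigma1Sound T) {φ : Formula} (hφ : IsSigmaB φ)
    (hs : Sentence φ) (hp : Provable T φ) (w : ℕ → ℕ) : Nst.sat φ w := by
  have hs' : Sentence φ.unbox := by
    have := φ.unbox_fv
    rw [hs] at this
    exact Finset.subset_empty.1 this
  have hp' : Provable T φ.unbox := by
    apply prov_of_models hT (K := φ.mx + φ.unbox.mx + 3) (by omega) (by omega) hs'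
    intro A hA _ v
    rw [A.sat_unbox]
    exact hA φ (by omega) hp v
  have := h1 _ hφ.unbox hs' hp'
  rw [StdTrue, val_sat hφ.unbox.noBox, Nst.sat_unbox] at this
  exact (Nst.sat_congr (fun y hy => by rw [hs] at hy; simp at hy)).1 this

theorem one_two (hT : Extends T PAVer) (h1 : Sigma1Sound T) : HasDP T IsSigmaB := by
  intro φ ψ hφ hψ sφ sψ hp
  have := sound_true hT h1 (hφ.or hψ) (by simp [Sentence, Formula.fv] at *; simp [sφ, sψ]) hp
    (fun _ => 0)
  exact this.imp (true_prov hT hφ sφ) (true_prov hT hψ sψ)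

theorem fv_subst_numeral {φ : Formula} {x n : ℕ} (h : φ.fv ⊆ {x}) :
    (φ.subst x (Term.numeral n)).fv = ∅ := by
  apply Finset.eq_empty_of_forall_notMem
  intro y
  apply Formula.notin_fv_substAll
  intro z hz
  have := h hz
  rw [Finset.mem_singleton] at this
  subst this
  simp [Term.numeral_fv_s14]

theorem one_four (hT : Extends T PAVer) (h1 : Sigma1Sound T) : HasEP T IsSigmaB := by
  intro x φ hφ hx hp
  obtain ⟨n, hn⟩ := sound_true hT h1 hφ.ex (by
    simp only [Sentence, Formula.fv]
    apply Finset.eq_empty_of_forall_notMem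
    intro y hy
    rw [Finset.mem_erase] at hy
    exact hy.1 (Finset.mem_singleton.1 (hx hy.2))) hp (fun _ => 0)
  refine ⟨n, ?_⟩
  apply prov_of_models hT (K := φ.mx + 3) (by omega)
    (Formula.mx_subst _ _ _ (by omega) (by simp [Term.numeral_mx])) (fv_subst_numeral hx)
  intro A _ hA v
  rw [A.sat_subst_numeral]
  refine hA.sigmaB' hφ (fun y hy => ?_) hn
  rw [Finset.mem_singleton.1 (hx hy)]
  simp

theorem four_five (h : HasEP T IsSigmaB) : HasEP T IsDeltaB :=
  fun x φ hφ => h x φ hφ.sigmaB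

theorem five_one (hT : Extends T PAVer) (hcon : Consistent T) (h : HasEP T IsDeltaB) :
    Sigma1Sound T := by
  intro σ hσ hs hp
  rw [StdTrue, val_sat hσ.noBox]
  set K := σ.mx + 5 with hK
  obtain ⟨σ', b⟩ := sigma1_bound hσ (N := σ.mx) (z := σ.mx + 3) (u := σ.mx + 4) (K := K) le_rfl
    (by omega) (by omega) (by omega) (by omega) (by omega)
  have hfv : σ'.fv ⊆ {σ.mx + 3} := by
    have := b.fv
    rwa [hs] at this
  obtain ⟨n, hn⟩ := h (σ.mx + 3) σ' (.delta0 b.d0) hfv (by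
    apply prov_of_models hT (K := K) (by omega)
    · simp only [Formula.mx, max_le_iff]; exact ⟨by omega, b.mx⟩
    · simp only [Sentence, Formula.fv]
      apply Finset.eq_empty_of_forall_notMem
      intro y hy
      rw [Finset.mem_erase] at hy
      exact hy.1 (Finset.mem_singleton.1 (hfv hy.2))
    · intro A hA hA' v
      exact (b.equiv A hA' v).1 (hA σ (by omega) hp v))
  obtain ⟨A, hA, hA'⟩ := exists_model hT hcon (K := K) (by omega)
  have := hA _ (Formula.mx_subst _ _ _ b.mx (by simp [Term.numeral_mx])) hn (fun _ => A.z)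
  rw [A.sat_subst_numeral] at this
  rw [b.equiv Nst (Nst_pa (by omega))]
  refine ⟨n, (hA'.delta0' b.d0 ?_).1 this⟩
  intro y hy
  rw [Finset.mem_singleton.1 (hfv hy)]
  simp

theorem noBox_substAll {φ : Formula} (h : φ.noBox) (f : ℕ → Term) : (φ.substAll f).noBox := by
  induction φ generalizing f <;> simp_all [Formula.substAll, Formula.noBox]

theorem pr_std (P : ProvPred T) {φ : Formula} {n : ℕ} (hn : n = φ.code) {w : ℕ → ℕ} (hw : w 0 = n) :
    Nst.sat P.pr w ↔ Provable T φ := by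
  rw [← P.numerates, StdTrue, 
    val_sat (φ := P.pr.subst 0 (Term.numeral φ.code)) (noBox_substAll P.noBox _), Nst.sat_subst_numeral]
  apply Nst.sat_congr
  intro y hy
  rw [Finset.mem_singleton.1 (P.fvSub hy)]
  simp [hw, hn, Nst_nm]

theorem one_six (hT : Extends T PAVer) (P : ProvPred T) (h1 : Sigma1Sound T) :
    DC T P IsSigmaB := by
  intro φ hφ sφ hp
  have hm := P.pr.mx
  let χ : Formula := φ.or (.ex 0 (.and (.eq (.var 0) (.numeral φ.code)) P.pr))
  have hχ : IsSigmaB χ := hφ.or (.sigma1 (.ex (.and (.delta0 (.eq _ _)) P.sigma1)))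
  have sχ : Sentence χ := by
    have h := P.fvSub
    apply Finset.eq_empty_of_forall_notMem
    intro y hy
    have h := @h y
    simp only [Sentence] at sφ
    simp only [χ, Formula.fv, Term.fv, Term.numeral_fv_s14, sφ, Finset.mem_union, Finset.mem_erase,
      Finset.mem_singleton, Finset.notMem_empty] at hy h
    tauto
  have e : ∀ (A : Str) v, A.sat χ v ↔ A.sat (φ.or (P.app φ)) v := by
    intro A v
    simp only [χ, ProvPred.app, Str.sat, A.sat_subst_numeral, A.tval_numeral, Str.tval]
    simp
  have := sound_true hT h1 hχ sχ (by
    apply prov_of_models hT (K := χ.mx + (φ.or (P.app φ)).mx + 3) (by omega) (by omega) sχ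
    intro A hA _ v
    rw [e]
    exact hA _ (by omega) hp v) (fun _ => 0)
  rw [e] at this
  rcases this with h | h
  · exact true_prov hT hφ sφ h
  · rw [ProvPred.app, Nst.sat_subst_numeral] at h
    exact (pr_std P rfl (by simp [Nst_nm])).1 h

end Transfer

/-! ### Σ₁ definition of diagonalization in the standard model -/

theorem Term.numeral_val (n : ℕ) (w : ℕ → ℕ) : (Term.numeral n).val w = n := by
  induction n <;> simp_all [Term.numeral, Term.val]

/-- `c = pair a b`. -/
def pairF (a b c : Term) : Formula :=
  .or (.and (.lt a b) (.eq c (.add (.mul b b) a)))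
    (.and (.le b a) (.eq c (.add (.add (.mul a a) a) b)))

theorem pairF_d0 (a b c : Term) : IsDelta0 (pairF a b c) :=
  .or (.and (.le _ _) (.eq _ _)) (.and (.le _ _) (.eq _ _))

theorem pairF_val (a b c : Term) (w : ℕ → ℕ) :
    (pairF a b c).val w ↔ c.val w = Nat.pair (a.val w) (b.val w) := by
  simp only [pairF, Formula.lt, Formula.val, Term.val, Nat.pair, Nat.succ_le_iff]
  split_ifs with h
  · constructor
    · rintro (h1 | h1)
      · exact h1.2
      · omega
    · intro h1; exact Or.inl ⟨h, h1⟩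
  · constructor
    · rintro (h1 | h1)
      · omega
      · exact h1.2
    · intro h1; exact Or.inr ⟨by omega, h1⟩

/-- The modulus of the β function. -/
def modT (d i : Term) : Term := .succ (.mul (.succ i) d)

/-- `r = a % ((i + 1) * d + 1)`; uses variable `7`. -/
def betaF (a d i r : Term) : Formula :=
  .and (.lt r (modT d i)) (.ex 7 (.eq a (.add (.mul (.var 7) (modT d i)) r)))

theorem betaF_s1 (a d i r : Term) : IsSigma1 (betaF a d i r) :=
  .and (.delta0 (.le _ _)) (.ex (.delta0 (.eq _ _)))

theorem val_upd_notin {t : Term} {x : ℕ} (hx : x ∉ t.fv) (w : ℕ → ℕ) (a : ℕ) :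
    t.val (Function.update w x a) = t.val w := by
  rw [val_tval, val_tval]
  exact Nst.tval_upd_notin hx w a

theorem betaF_val {a d i r : Term} (ha : 7 ∉ a.fv) (hd : 7 ∉ d.fv) (hi : 7 ∉ i.fv) (hr : 7 ∉ r.fv)
    (w : ℕ → ℕ) :
    (betaF a d i r).val w ↔ r.val w = a.val w % ((i.val w + 1) * d.val w + 1) := by
  simp only [betaF, modT, Formula.lt, Formula.val, Term.val, Function.update_self,
    val_upd_notin ha, val_upd_notin hd, val_upd_notin hi, val_upd_notin hr, Nat.succ_le_iff]
  have hm : 0 < (i.val w + 1) * d.val w + 1 := Nat.succ_pos _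
  generalize (i.val w + 1) * d.val w + 1 = m at hm
  constructor
  · rintro ⟨h1, q, hq⟩
    rw [hq, Nat.mul_comm, Nat.mul_add_mod, Nat.mod_eq_of_lt h1]
  · intro h
    exact ⟨h ▸ Nat.mod_lt _ hm, a.val w / m, by
      rw [h, Nat.mul_comm]; exact (Nat.div_add_mod _ _).symm⟩

/-- `v8 = code (numeral v1)`. -/
def cF : Formula :=
  .ex 2 (.ex 3 (.and (betaF (.var 2) (.var 3) .zero (.numeral 2))
    (.and (.ball 4 (.var 1) (.ex 5 (.ex 6 (.and (betaF (.var 2) (.var 3) (.var 4) (.var 5))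
      (.and (betaF (.var 2) (.var 3) (.succ (.var 4)) (.var 6))
        (pairF (.numeral 2) (.var 5) (.var 6)))))))
      (betaF (.var 2) (.var 3) (.var 1) (.var 8)))))

theorem cF_s1 : IsSigma1 cF :=
  .ex (.ex (.and (betaF_s1 _ _ _ _) (.and (.ball (by simp [Term.fv]) (.ex (.ex (.and (betaF_s1 _ _ _ _)
    (.and (betaF_s1 _ _ _ _) (.delta0 (pairF_d0 _ _ _))))))) (betaF_s1 _ _ _ _))))

theorem cF_val (w : ℕ → ℕ) : cF.val w ↔ w 8 = (Term.numeral (w 1)).code := by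
  have key : cF.val w ↔ ∃ a d : ℕ, 2 = a % ((0 + 1) * d + 1) ∧
      (∀ i < w 1, a % ((i + 1 + 1) * d + 1) = Nat.pair 2 (a % ((i + 1) * d + 1))) ∧
      w 8 = a % ((w 1 + 1) * d + 1) := by
    simp only [cF, Formula.ball, Formula.lt, Formula.val]
    refine exists_congr fun a => exists_congr fun d => ?_
    rw [betaF_val, betaF_val]
    rotate_left
    · simp [Term.fv]
    · simp [Term.fv]
    · simp [Term.fv]
    · simp [Term.fv]
    · simp [Term.fv]
    · simp [Term.fv]
    · simp [Term.fv]
    · simp [Term.fv, Term.numeral]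
    refine and_congr ?_ (and_congr ?_ ?_)
    · simp [Term.val, Term.numeral_val]
    · refine forall_congr' fun i => ?_
      refine imp_congr (by simp [Term.val]) ?_
      constructor
      · rintro ⟨r, s, h1, h2, h3⟩
        rw [betaF_val (by simp [Term.fv]) (by simp [Term.fv]) (by simp [Term.fv])
          (by simp [Term.fv])] at h1 h2
        rw [pairF_val] at h3
        simp [Term.val, Term.numeral_val] at h1 h2 h3
        rw [← h1, ← h2, h3]
      · intro h
        refine ⟨a % ((i + 1) * d + 1), a % ((i + 1 + 1) * d + 1), ?_, ?_, ?_⟩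
        · rw [betaF_val (by simp [Term.fv]) (by simp [Term.fv]) (by simp [Term.fv])
            (by simp [Term.fv])]
          simp [Term.val]
        · rw [betaF_val (by simp [Term.fv]) (by simp [Term.fv]) (by simp [Term.fv])
            (by simp [Term.fv])]
          simp [Term.val]
        · rw [pairF_val]
          simpa [Term.val, Term.numeral_val] using h
    · simp [Term.val]
  rw [key]
  generalize w 1 = n
  generalize w 8 = c
  constructor
  · rintro ⟨a, d, h0, hs, rfl⟩
    have : ∀ i, i ≤ n → a % ((i + 1) * d + 1) = (Term.numeral i).code := by
      intro i
      induction i with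
      | zero => intro _; rw [← h0]; rfl
      | succ i ih => intro hi; rw [hs i (by omega), ih (by omega)]; rfl
    exact this n le_rfl
  · rintro rfl
    let l : List ℕ := (List.range (n + 1)).map fun i => (Term.numeral i).code
    have hl : ∀ i ≤ n, (Nat.unbeta l).unpair.1 % ((i + 1) * (Nat.unbeta l).unpair.2 + 1) =
        (Term.numeral i).code := by
      intro i hi
      have := Nat.beta_unbeta_coe l ⟨i, by simp [l]; omega⟩
      simpa [Nat.beta, l] using this
    refine ⟨(Nat.unbeta l).unpair.1, (Nat.unbeta l).unpair.2, ?_, ?_, ?_⟩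
    · rw [hl 0 (by omega)]; rfl
    · intro i hi
      rw [hl (i + 1) (by omega), hl i (by omega)]; rfl
    · rw [hl n le_rfl]

/-- The diagonal instance of a formula. -/
def diag (θ : Formula) (n : ℕ) : Formula := .ex 1 (.and (.eq (.var 1) (.numeral n)) θ)

/-- Code of the diagonal instance. -/
def diagCode (n : ℕ) : ℕ :=
  Nat.pair 8 (Nat.pair 1 (Nat.pair 3 (Nat.pair (Nat.pair 1 (Nat.pair (Nat.pair 0 1)
    (Term.numeral n).code)) n)))

theorem diag_code (θ : Formula) : (diag θ θ.code).code = diagCode θ.code := rfl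

/-- `v_o = diagCode v1`. -/
def diagF (o : ℕ) : Formula :=
  .ex 8 (.and cF (.ex 9 (.and (pairF (.numeral 1) (.var 8) (.var 9))
    (.ex 10 (.and (pairF (.numeral 1) (.var 9) (.var 10))
    (.ex 11 (.and (pairF (.var 10) (.var 1) (.var 11))
    (.ex 12 (.and (pairF (.numeral 3) (.var 11) (.var 12))
    (.ex 13 (.and (pairF (.numeral 1) (.var 12) (.var 13))
    (pairF (.numeral 8) (.var 13) (.var o)))))))))))))

theorem diagF_s1 (o : ℕ) : IsSigma1 (diagF o) :=
  .ex (.and cF_s1 (.ex (.and (.delta0 (pairF_d0 _ _ _)) (.ex (.and (.delta0 (pairF_d0 _ _ _))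
    (.ex (.and (.delta0 (pairF_d0 _ _ _)) (.ex (.and (.delta0 (pairF_d0 _ _ _))
    (.ex (.and (.delta0 (pairF_d0 _ _ _)) (.delta0 (pairF_d0 _ _ _)))))))))))))

theorem diagF_val {o : ℕ} (ho : o = 0 ∨ o = 14) (w : ℕ → ℕ) :
    (diagF o).val w ↔ w o = diagCode (w 1) := by
  have e : Nat.pair 0 1 = 1 := rfl
  rcases ho with rfl | rfl <;>
  simp [diagF, diagCode, e, Formula.val, cF_val, pairF_val, Term.val, Term.numeral_val]

/-- `v0 = code of the negation of the diagonal instance`. -/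
def ndiagF : Formula := .ex 14 (.and (diagF 14) (pairF (.numeral 6) (.var 14) (.var 0)))

theorem ndiagF_s1 : IsSigma1 ndiagF := .ex (.and (diagF_s1 _) (.delta0 (pairF_d0 _ _ _)))

theorem ndiagF_val (w : ℕ → ℕ) : ndiagF.val w ↔ w 0 = Nat.pair 6 (diagCode (w 1)) := by
  simp [ndiagF, Formula.val, diagF_val, pairF_val, Term.val, Term.numeral_val]

theorem diagF_fv : (diagF 0).fv ⊆ {0, 1} := by
  decide

theorem ndiagF_fv : ndiagF.fv ⊆ {0, 1} := by
  decide

/-! ### The hard implications -/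

theorem PAModel.anti {K K' : ℕ} {A : Str} (h : PAModel K A) (hK' : 3 ≤ K') (hle : K' ≤ K) :
    PAModel K' A where
  hK := hK'
  s_ne := h.s_ne
  s_inj := h.s_inj
  add_z := h.add_z
  add_s := h.add_s
  mul_z := h.mul_z
  mul_s := h.mul_s
  le_iff := h.le_iff
  ind := fun x φ hx hφ => h.ind x φ (by omega) (by omega)

theorem upd2 {M : Type} (v : ℕ → M) (x y : ℕ) (a : M) (h : x ≠ y) : Function.update v x a y = v y := by
  rw [Function.update_of_ne h.symm]

theorem exists_G : ∃ (K₁ : ℕ) (G : Formula), 3 ≤ K₁ ∧ G.mx ≤ K₁ ∧ IsSigma1 G ∧ G.fv ⊆ {0, 1} ∧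
    (∀ w : ℕ → ℕ, w 0 = diagCode (w 1) → Nst.sat G w) ∧
    (∀ K A, K₁ ≤ K → PAModel K A → ∀ (v : ℕ → A.M) (n : ℕ), v 1 = A.nm n → A.sat G v →
      v 0 = A.nm (diagCode n)) := by
  obtain ⟨m, hm⟩ : ∃ m, m = (diagF 0).mx + 20 := ⟨_, rfl⟩
  obtain ⟨δ', b⟩ := sigma1_bound (diagF_s1 0) (N := m) (z := m) (u := m + 1) (K := m + 2) (by omega)
    (by omega) (by omega) (by omega) (by omega) (by omega)
  have hfv : ∀ y ∈ δ'.fv, y = m ∨ y = 0 ∨ y = 1 := by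
    intro y hy
    have h1 := b.fv hy
    rw [Finset.mem_insert] at h1
    rcases h1 with h1 | h1
    · exact Or.inl h1
    · have := diagF_fv h1
      simp only [Finset.mem_insert, Finset.mem_singleton] at this
      exact Or.inr this
  have h0 : 0 ∉ (Term.var m).succ.fv := by simp [Term.fv]; omega
  have hu' : m + 1 ∉ δ'.fv := fun h => by have := hfv _ h; omega
  let E : Formula := .bex 0 (.succ (.var m)) δ'
  have Ed : IsDelta0 E := .bex h0 b.d0
  have Efv : ∀ y ∈ E.fv, y = m ∨ y = 1 := by
    intro y hy
    simp only [E, Formula.bex, Formula.lt, Formula.fv, Term.fv, Finset.mem_erase, Finset.mem_union,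
      Finset.mem_singleton] at hy
    have := hfv y
    tauto
  have Emx : E.mx ≤ m + 2 := by
    have := b.mx
    simp only [E, Formula.bex, Formula.lt, Formula.mx, Term.mx, max_le_iff]
    omega
  have hu : m + 1 ∉ E.neg.fv := fun h => by have := Efv _ h; omega
  have hum : m + 1 ∉ (Term.var m).fv := by simp [Term.fv]
  let G : Formula := .ex m (.and (.lt (.var 0) (.succ (.var m)))
    (.and δ' (allBelow (m + 1) m (.var m) E.neg)))
  have Esat : ∀ {K} {A : Str}, m + 2 ≤ K → PAModel K A → ∀ (v : ℕ → A.M) a,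
      A.sat E (Function.update v m a) ↔ ∃ c, A.le c a ∧
        A.sat δ' (Function.update (Function.update v 0 c) m a) := by
    intro K A hK hA v a
    simp only [E, A.sat_bex h0, Str.tval, Function.update_self, hA.s_le_s]
    simp only [Function.update_comm (show m ≠ 0 by omega)]
  have Gsat : ∀ {K} {A : Str}, m + 2 ≤ K → PAModel K A → ∀ v : ℕ → A.M, A.sat G v ↔
      ∃ a, A.le (v 0) a ∧ A.sat δ' (Function.update v m a) ∧
        ∀ c, A.le (A.s c) a → ¬ A.sat E (Function.update v m c) := by
    intro K A hK hA v
    simp only [G, Formula.lt]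
    simp only [Str.sat.eq_9, Str.sat.eq_4, Str.sat.eq_3,
      Str.sat_allBelow hA (show m ≠ m + 1 by omega) hum hu, Str.tval, Function.update_self, hA.s_le_s,
      Str.sat.eq_7, Function.update_idem, upd2 _ _ _ _ (show m ≠ 0 by omega)]
  have Nst1 : PAModel (m + 2) Nst := Nst_pa (by omega)
  have dsat : ∀ w : ℕ → ℕ, Nst.sat (diagF 0) w ↔ w 0 = diagCode (w 1) := by
    intro w
    rw [← val_sat (diagF_s1 0).noBox, diagF_val (Or.inl rfl)]
  have G1 : ∀ w : ℕ → ℕ, w 0 = diagCode (w 1) → Nst.sat G w := by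
    intro w hw
    obtain ⟨a, ha⟩ := (b.equiv Nst Nst1 w).1 ((dsat w).2 hw)
    have hE : ∃ a, Nst.sat E (Function.update w m a) := by
      refine ⟨Nst.a (w 0) a, (Esat le_rfl Nst1 _ _).2 ⟨w 0, Nst1.le_add _ _, ?_⟩⟩
      rw [Function.update_eq_self]
      exact b.mono Nst Nst1 _ _ _ (Nst1.le_add' _ _) ha
    obtain ⟨a, ha, hmin⟩ := Nst1.lnp Emx (z := m) (u := m + 1) (by omega) (by omega) (by omega) hu w hE
    obtain ⟨c, hc, hs⟩ := (Esat le_rfl Nst1 _ _).1 ha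
    have hd := (b.equiv Nst Nst1 _).2 ⟨a, hs⟩
    rw [dsat] at hd
    rw [Function.update_self, upd2 _ _ _ _ (show 0 ≠ 1 by omega), ← hw] at hd
    subst hd
    rw [Function.update_eq_self] at hs
    exact (Gsat le_rfl Nst1 _).2 ⟨a, hc, hs, hmin⟩
  refine ⟨m + 2, G, by omega, ?_, ?_, ?_, G1, ?_⟩
  · have := allBelow_mx (K := m + 2) (u := m + 1) (z := m) (t := .var m) (χ := E.neg) (by omega)
      (by omega) (by simp [Term.mx]) Emx
    have := b.mx
    simp only [G, Formula.lt, Formula.mx, Term.mx, max_le_iff]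
    omega
  · exact .ex (.delta0 (.and (.le _ _) (.and b.d0 (.allBelow (by omega) hum Ed.neg))))
  · intro y hy
    simp only [G, Formula.lt, Formula.fv, Term.fv, Finset.mem_erase, Finset.mem_union,
      Finset.mem_singleton] at hy
    simp only [Finset.mem_insert, Finset.mem_singleton]
    rcases hy with ⟨hne, (h | h) | h | h⟩
    · exact Or.inl h
    · exact (hne h).elim
    · exact (hfv y h).resolve_left hne
    · have := allBelow_fv h
      simp only [Term.fv, Finset.mem_erase, Finset.mem_union, Finset.mem_singleton] at this
      rcases this with h | ⟨_, h⟩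
      · exact (hne h).elim
      · exact Or.inr ((Efv y h).resolve_left hne)
  · intro K A hK hA v n hv hs
    obtain ⟨a, ha0, had, hmin⟩ := (Gsat hK hA v).1 hs
    have hA1 := hA.anti (show 3 ≤ m + 2 by omega) hK
    let w : ℕ → ℕ := Function.update (fun _ => n) 0 (diagCode n)
    obtain ⟨p, hp0, hpd, _⟩ := (Gsat le_rfl Nst1 w).1 (G1 w (by simp [w]))
    have hE : Nst.sat E (Function.update w m p) := by
      refine (Esat le_rfl Nst1 _ _).2 ⟨w 0, hp0, ?_⟩
      rw [Function.update_eq_self]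
      exact hpd
    rcases hA.total a (A.nm p) with h | h
    · obtain ⟨k, hk, rfl⟩ := hA.le_nm h
      obtain ⟨j, hj, hv0⟩ := hA.le_nm ha0
      have := (hA.delta0' b.d0 (w := Function.update (Function.update w 0 j) m k) (by
        intro y hy
        rcases hfv y hy with rfl | rfl | rfl
        · simp
        · rw [upd2 _ _ _ _ (by omega), upd2 _ _ _ _ (by omega), Function.update_self, hv0]
        · rw [upd2 _ _ _ _ (by omega), upd2 _ _ _ _ (by omega), upd2 _ _ _ _ (by omega), hv]
          simp [w])).1 had
      have hd := (b.equiv Nst Nst1 _).2 ⟨k, this⟩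
      rw [dsat] at hd
      simp [w] at hd
      rw [hv0, hd]
    · refine (hmin _ h ?_).elim
      refine (hA.delta0' Ed ?_).2 hE
      intro y hy
      rcases Efv y hy with rfl | rfl
      · simp
      · rw [upd2 _ _ _ _ (by omega), upd2 _ _ _ _ (by omega), hv]
        simp [w]

theorem Str.sat_diag (A : Str) (θ : Formula) (n : ℕ) (v : ℕ → A.M) :
    A.sat (diag θ n) v ↔ A.sat θ (Function.update v 1 (A.nm n)) := by
  simp only [diag, Str.sat, Str.tval, A.tval_numeral, Function.update_self]
  simp

theorem diag_fv {θ : Formula} (h : θ.fv ⊆ {1}) (n : ℕ) : Sentence (diag θ n) := by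
  apply Finset.eq_empty_of_forall_notMem
  intro y hy
  have h := @h y
  simp only [diag, Formula.fv, Term.fv, Term.numeral_fv_s14, Finset.mem_erase, Finset.mem_union,
    Finset.mem_singleton, Finset.notMem_empty] at hy h
  tauto

theorem diag_mx {θ : Formula} {K : ℕ} (h : θ.mx ≤ K) (hK : 3 ≤ K) (n : ℕ) : (diag θ n).mx ≤ K := by
  simp only [diag, Formula.mx, Term.mx, Term.numeral_mx, max_le_iff]
  omega

theorem IsSigma1.diag {θ : Formula} (h : IsSigma1 θ) (n : ℕ) : IsSigma1 (diag θ n) :=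
  .ex (.and (.delta0 (.eq _ _)) h)

section Hard

variable {T : Set Formula}

set_option maxHeartbeats 4000000 in
theorem six_one (hT : Extends T PAVer) (hcon : Consistent T) (P : ProvPred T)
    (hdc : DC T P IsSigmaB) : Sigma1Sound T := by
  intro σ hσ sσ hp
  by_contra hfalse
  rw [StdTrue, val_sat hσ.noBox] at hfalse
  obtain ⟨K₁, G, hK1, Gmx, Gs, Gfv, GN, GA⟩ := exists_G
  obtain ⟨m, hm⟩ : ∃ m, m = K₁ + P.pr.mx + σ.mx + 5 := ⟨_, rfl⟩
  let β : Formula := .ex 0 (.and G P.pr)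
  have βs : IsSigma1 β := .ex (.and Gs P.sigma1)
  have βfv : ∀ y ∈ β.fv, y = 1 := by
    intro y hy
    have h1 := @Gfv y
    have h2 := @P.fvSub y
    simp only [β, Formula.fv, Finset.mem_erase, Finset.mem_union, Finset.mem_insert,
      Finset.mem_singleton] at hy h1 h2
    tauto
  obtain ⟨β', bβ⟩ := sigma1_bound βs (N := m) (z := m) (u := m + 1) (K := m + 2)
    (by simp only [β, Formula.mx, max_le_iff]; omega)
    (by omega) (by omega) (by omega) (by omega) (by omega)
  obtain ⟨σ', bσ⟩ := sigma1_bound hσ (N := m) (z := m) (u := m + 1) (K := m + 2) (by omega)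
    (by omega) (by omega) (by omega) (by omega) (by omega)
  have β'fv : ∀ y ∈ β'.fv, y = m ∨ y = 1 := by
    intro y hy
    have := bβ.fv hy
    rw [Finset.mem_insert] at this
    exact this.imp_right (βfv y)
  have σ'fv : ∀ y ∈ σ'.fv, y = m := by
    intro y hy
    have := bσ.fv hy
    rw [sσ] at this
    simpa using this
  let φ : Formula := .ex m (.and σ' (.neg β'))
  have φs : IsSigma1 φ := .ex (.delta0 (.and bσ.d0 (.neg bβ.d0)))
  have φfv : φ.fv ⊆ {1} := by
    intro y hy
    have h1 := β'fv y
    have h2 := σ'fv y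
    simp only [φ, Formula.fv, Finset.mem_erase, Finset.mem_union] at hy
    rw [Finset.mem_singleton]
    tauto
  have φmx : φ.mx ≤ m + 2 := by
    have h1 := bβ.mx
    have h2 := bσ.mx
    simp only [φ, Formula.mx, max_le_iff]
    omega
  obtain ⟨n, hn⟩ : ∃ n, n = φ.code := ⟨_, rfl⟩
  have hcode : (diag φ n).code = diagCode n := by rw [hn]; exact diag_code φ
  have sχ := diag_fv φfv n
  have χmx := diag_mx φmx (by omega) n
  have hprov : Provable T (diag φ n) := by
    apply hdc _ (.sigma1 (φs.diag n)) sχ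
    have appmx : (P.app (diag φ n)).mx ≤ m + 2 :=
      Formula.mx_subst _ _ _ (by omega) (by simp [Term.numeral_mx])
    apply prov_of_models hT (K := m + 2) (by omega)
    · simp only [Formula.mx, max_le_iff]; exact ⟨χmx, appmx⟩
    · have := fv_subst_numeral (n := (diag φ n).code) P.fvSub
      unfold Sentence at sχ ⊢
      simp only [Formula.fv, ProvPred.app, this, sχ]
      rfl
    · intro A hA hA' v
      have hs := hA σ (by omega) hp (Function.update v 1 (A.nm n))
      obtain ⟨a, ha⟩ := (bσ.equiv A hA' _).1 hs
      by_cases hb : A.sat β' (Function.update (Function.update v 1 (A.nm n)) m a)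
      · right
        obtain ⟨c, hG, hpr⟩ := (bβ.equiv A hA' _).2 ⟨a, hb⟩
        have hc := GA _ A (by omega) hA' _ n (by
          rw [upd2 _ _ _ _ (by omega), Function.update_self]) hG
        rw [Function.update_self, ← hcode] at hc
        subst hc
        rw [ProvPred.app, A.sat_subst_numeral]
        refine (A.sat_congr ?_).1 hpr
        intro y hy
        rw [Finset.mem_singleton.1 (P.fvSub hy)]
        simp
      · left
        rw [A.sat_diag]
        exact ⟨a, ha, hb⟩
  have NP : PAModel (m + 2) Nst := Nst_pa (by omega)
  let w : ℕ → ℕ := fun _ => n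
  have hβ : Nst.sat β w := by
    refine ⟨diagCode n, GN _ (by simp [w]), ?_⟩
    exact (pr_std P hcode.symm (by simp)).2 hprov
  obtain ⟨p, hpβ⟩ := (bβ.equiv Nst NP w).1 hβ
  obtain ⟨A, hA, hA'⟩ := exists_model hT hcon (K := m + 2) (by omega)
  have := hA _ χmx hprov (fun _ => A.z)
  rw [A.sat_diag] at this
  obtain ⟨a, ha, hna⟩ := this
  rcases hA'.total a (A.nm p) with h | h
  · obtain ⟨k, hk, rfl⟩ := hA'.le_nm h
    apply hfalse
    have := (hA'.delta0' bσ.d0 (w := Function.update (fun _ => 0) m k) (by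
      intro y hy
      rw [σ'fv y hy]
      simp)).1 ha
    exact (bσ.equiv Nst NP _).2 ⟨k, this⟩
  · apply hna
    refine bβ.mono A hA' _ _ _ (hA'.le_trans (hA'.le_s _) h) ?_
    refine (hA'.delta0' bβ.d0 ?_).2 hpβ
    intro y hy
    rcases β'fv y hy with rfl | rfl
    · simp
    · rw [upd2 _ m 1 _ (by omega), upd2 _ m 1 _ (by omega), Function.update_self]

set_option maxHeartbeats 4000000 in
theorem three_one (hT : Extends T PAVer) (hcon : Consistent T) (P : ProvPred T)
    (hdp : HasDP2 T IsSigmaB IsSigma1) : Sigma1Sound T := by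
  intro σ hσ sσ hp
  by_contra hfalse
  rw [StdTrue, val_sat hσ.noBox] at hfalse
  obtain ⟨m, hm⟩ : ∃ m, m = (diagF 0).mx + ndiagF.mx + P.pr.mx + σ.mx + 20 := ⟨_, rfl⟩
  let β : Formula := .ex 0 (.and (diagF 0) P.pr)
  let α : Formula := .or σ (.ex 0 (.and ndiagF P.pr))
  have βs : IsSigma1 β := .ex (.and (diagF_s1 0) P.sigma1)
  have αs : IsSigma1 α := .or hσ (.ex (.and ndiagF_s1 P.sigma1))
  have βfv : ∀ y ∈ β.fv, y = 1 := by
    intro y hy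
    have h1 := @diagF_fv y
    have h2 := @P.fvSub y
    simp only [β, Formula.fv, Finset.mem_erase, Finset.mem_union, Finset.mem_insert,
      Finset.mem_singleton] at hy h1 h2
    tauto
  have αfv : ∀ y ∈ α.fv, y = 1 := by
    intro y hy
    have h1 := @ndiagF_fv y
    have h2 := @P.fvSub y
    unfold Sentence at sσ
    simp only [α, Formula.fv, sσ, Finset.mem_erase, Finset.mem_union, Finset.mem_insert,
      Finset.mem_singleton, Finset.notMem_empty] at hy h1 h2
    tauto
  obtain ⟨β', bβ⟩ := sigma1_bound βs (N := m) (z := m) (u := m + 1) (K := m + 2)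
    (by simp only [β, Formula.mx, max_le_iff]; omega)
    (by omega) (by omega) (by omega) (by omega) (by omega)
  obtain ⟨α', bα⟩ := sigma1_bound αs (N := m) (z := m) (u := m + 1) (K := m + 2)
    (by simp only [α, Formula.mx, max_le_iff]; omega)
    (by omega) (by omega) (by omega) (by omega) (by omega)
  have β'fv : ∀ y ∈ β'.fv, y = m ∨ y = 1 := by
    intro y hy
    have := bβ.fv hy
    rw [Finset.mem_insert] at this
    exact this.imp_right (βfv y)
  have α'fv : ∀ y ∈ α'.fv, y = m ∨ y = 1 := by
    intro y hy
    have := bα.fv hy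
    rw [Finset.mem_insert] at this
    exact this.imp_right (αfv y)
  have huβ : m + 1 ∉ β'.neg.fv := fun h => by have := β'fv _ h; omega
  have huα : m + 1 ∉ α'.neg.fv := fun h => by have := α'fv _ h; omega
  have hum : m + 1 ∉ (Term.var m).fv := by simp [Term.fv]
  have hum' : m + 1 ∉ (Term.var m).succ.fv := by simp [Term.fv]
  let φ : Formula := .ex m (.and α' (allBelow (m + 1) m (.var m) β'.neg))
  let ψ : Formula := .ex m (.and β' (allBelow (m + 1) m (.succ (.var m)) α'.neg))
  have φs : IsSigma1 φ := .ex (.delta0 (.and bα.d0 (.allBelow (by omega) hum bβ.d0.neg)))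
  have ψs : IsSigma1 ψ := .ex (.delta0 (.and bβ.d0 (.allBelow (by omega) hum' bα.d0.neg)))
  have φfv : φ.fv ⊆ {1} := by
    intro y hy
    have h1 := β'fv y
    have h2 := α'fv y
    have h3 := @allBelow_fv (m + 1) m (.var m) β'.neg y
    simp only [φ, Formula.fv, Term.fv, Finset.mem_erase, Finset.mem_union,
      Finset.mem_singleton] at hy h3
    rw [Finset.mem_singleton]
    tauto
  have ψfv : ψ.fv ⊆ {1} := by
    intro y hy
    have h1 := β'fv y
    have h2 := α'fv y
    have h3 := @allBelow_fv (m + 1) m (.succ (.var m)) α'.neg y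
    simp only [ψ, Formula.fv, Term.fv, Finset.mem_erase, Finset.mem_union,
      Finset.mem_singleton] at hy h3
    rw [Finset.mem_singleton]
    tauto
  have φmx : φ.mx ≤ m + 2 := by
    have h1 := bα.mx
    have h2 := allBelow_mx (K := m + 2) (u := m + 1) (z := m) (t := .var m) (χ := β'.neg) (by omega)
      (by omega) (by simp [Term.mx]) bβ.mx
    simp only [φ, Formula.mx, max_le_iff]
    omega
  have ψmx : ψ.mx ≤ m + 2 := by
    have h1 := bβ.mx
    have h2 := allBelow_mx (K := m + 2) (u := m + 1) (z := m) (t := .succ (.var m)) (χ := α'.neg)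
      (by omega) (by omega) (by simp [Term.mx]) bα.mx
    simp only [ψ, Formula.mx, max_le_iff]
    omega
  have φsat : ∀ {A : Str}, PAModel (m + 2) A → ∀ v : ℕ → A.M, A.sat φ v ↔
      ∃ a, A.sat α' (Function.update v m a) ∧
        ∀ c, A.le (A.s c) a → ¬ A.sat β' (Function.update v m c) := by
    intro A hA v
    simp only [φ, Str.sat.eq_9, Str.sat.eq_4,
      Str.sat_allBelow hA (show m ≠ m + 1 by omega) hum huβ, Str.tval, Function.update_self,
      Str.sat.eq_7, Function.update_idem]
  have ψsat : ∀ {A : Str}, PAModel (m + 2) A → ∀ v : ℕ → A.M, A.sat ψ v ↔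
      ∃ a, A.sat β' (Function.update v m a) ∧
        ∀ c, A.le c a → ¬ A.sat α' (Function.update v m c) := by
    intro A hA v
    simp only [ψ, Str.sat.eq_9, Str.sat.eq_4,
      Str.sat_allBelow hA (show m ≠ m + 1 by omega) hum' huα, Str.tval, Function.update_self,
      Str.sat.eq_7, Function.update_idem, hA.s_le_s]
  obtain ⟨n, hn⟩ : ∃ n, n = φ.code := ⟨_, rfl⟩
  have hcode : (diag φ n).code = diagCode n := by rw [hn]; exact diag_code φ
  have ncode : (diag φ n).neg.code = Nat.pair 6 (diagCode n) := by rw [← hcode]; rfl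
  have sφ := diag_fv φfv n
  have sψ := diag_fv ψfv n
  have χmx := diag_mx φmx (by omega) n
  have χmx' := diag_mx ψmx (by omega) n
  have NP : PAModel (m + 2) Nst := Nst_pa (by omega)
  have contra : ∀ {A : Str}, PAModel (m + 2) A → ∀ v : ℕ → A.M, A.sat φ v → A.sat ψ v → False := by
    intro A hA v h1 h2
    obtain ⟨a, ha, hb⟩ := (φsat hA v).1 h1
    obtain ⟨c, hc, hd⟩ := (ψsat hA v).1 h2
    rcases hA.total a c with h | h
    · exact hd a h ha
    · exact hb c h hc
  have hor : Provable T ((diag φ n).or (diag ψ n)) := by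
    apply prov_of_models hT (K := m + 2) (by omega)
    · simp only [Formula.mx, max_le_iff]; exact ⟨χmx, χmx'⟩
    · unfold Sentence at sφ sψ ⊢
      simp only [Formula.fv, sφ, sψ]
      rfl
    · intro A hA hA' v
      simp only [Str.sat.eq_5, A.sat_diag]
      generalize Function.update v 1 (A.nm n) = v
      obtain ⟨a, ha⟩ := (bα.equiv A hA' v).1 (Or.inl (hA σ (by omega) hp v))
      obtain ⟨a, ha, hmin⟩ := hA'.lnp (φ := .or α' β') (z := m) (u := m + 1)
        (by simp only [Formula.mx, max_le_iff]; exact ⟨bα.mx, bβ.mx⟩) (by omega) (by omega) (by omega)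
        (by
          intro h
          rcases Finset.mem_union.1 h with h | h
          · exact huα h
          · exact huβ h) v ⟨a, Or.inl ha⟩
      by_cases hα : A.sat α' (Function.update v m a)
      · left
        exact (φsat hA' v).2 ⟨a, hα, fun c hc h => hmin c hc (Or.inr h)⟩
      · right
        refine (ψsat hA' v).2 ⟨a, ha.resolve_left hα, fun c hc h => ?_⟩
        rcases hA'.lt_or_eq hc with h1 | rfl
        · exact hmin c h1 (Or.inl h)
        · exact hα h
  let w : ℕ → ℕ := fun _ => n
  have hβ : Nst.sat β w ↔ Provable T (diag φ n) := by
    constructor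
    · rintro ⟨c, hd, hpr⟩
      rw [← val_sat (diagF_s1 0).noBox, diagF_val (Or.inl rfl)] at hd
      exact (pr_std P hcode.symm hd).1 hpr
    · intro h
      refine ⟨diagCode n, ?_, (pr_std P hcode.symm (by simp)).2 h⟩
      rw [← val_sat (diagF_s1 0).noBox, diagF_val (Or.inl rfl)]
      simp [w]
  have hα : Nst.sat α w ↔ Provable T (diag φ n).neg := by
    constructor
    · rintro (h | ⟨c, hd, hpr⟩)
      · exact (hfalse ((Nst.sat_congr (fun y hy => by rw [sσ] at hy; simp at hy)).1 h)).elim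
      · rw [← val_sat ndiagF_s1.noBox, ndiagF_val] at hd
        exact (pr_std P ncode.symm hd).1 hpr
    · intro h
      refine Or.inr ⟨Nat.pair 6 (diagCode n), ?_, (pr_std P ncode.symm (by simp)).2 h⟩
      rw [← val_sat ndiagF_s1.noBox, ndiagF_val]
      simp [w]
  have hnot : ¬ (Provable T (diag φ n) ∧ Provable T (diag φ n).neg) := by
    rintro ⟨h1, h2⟩
    exact hcon (((Provable.logic (.negE (diag φ n) .falsum)).mp h2).mp h1)
  have updw : Function.update w 1 (Nst.nm n) = w := by
    funext y
    by_cases h : y = 1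
    · subst h; simp [w, Nst_nm]
    · simp [h, w]
  rcases hdp _ _ (.sigma1 (φs.diag n)) (ψs.diag n) sφ sψ hor with h | h
  · obtain ⟨p, hp'⟩ := (bβ.equiv Nst NP w).1 (hβ.2 h)
    have hψ : Nst.sat (diag ψ n) w := by
      rw [Nst.sat_diag, updw, ψsat NP]
      refine ⟨p, hp', fun c _ hc => hnot ⟨h, hα.1 ((bα.equiv Nst NP w).2 ⟨c, hc⟩)⟩⟩
    have h' := true_prov hT (.sigma1 (ψs.diag n)) sψ hψ
    obtain ⟨A, hA, hA'⟩ := exists_model hT hcon (K := m + 2) (by omega)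
    have h1 := hA _ χmx h (fun _ => A.z)
    have h2 := hA _ χmx' h' (fun _ => A.z)
    rw [A.sat_diag] at h1 h2
    exact contra hA' _ h1 h2
  · have hneg : Provable T (diag φ n).neg := by
      apply prov_of_models hT (φ := (diag φ n).neg) (K := m + 2) (by omega) χmx sφ
      intro A hA hA' v h1
      have h2 := hA _ χmx' h v
      rw [A.sat_diag] at h1 h2
      exact contra hA' _ h1 h2
    obtain ⟨p, hp'⟩ := (bα.equiv Nst NP w).1 (hα.2 hneg)
    have hφ : Nst.sat (diag φ n) w := by
      rw [Nst.sat_diag, updw, φsat NP]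
      refine ⟨p, hp', fun c _ hc => hnot ⟨hβ.1 ((bβ.equiv Nst NP w).2 ⟨c, hc⟩), hneg⟩⟩
    exact hnot ⟨true_prov hT (.sigma1 (φs.diag n)) sφ hφ, hneg⟩

end Hard
/-- For a consistent r.e. extension T of PA(Ver) (with natural provability
predicate P), the following are pairwise equivalent: Σ₁-soundness, ΣB-DP,
(ΣB, Σ₁)-DP, ΣB-EP, ΔB-EP, and ΣB-DC. -/
theorem statement14 (T : Set Formula) (hre : RE T) (hT : Extends T PAVer)
    (hcon : Consistent T) (P : ProvPred T) :
    List.TFAE [Sigma1Sound T, HasDP T IsSigmaB, HasDP2 T IsSigmaB IsSigma1,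
      HasEP T IsSigmaB, HasEP T IsDeltaB, DC T P IsSigmaB] := by
  tfae_have 1 → 2 := one_two hT
  tfae_have 2 → 3 := fun h φ ψ hφ hψ => h φ ψ hφ (.sigma1 hψ)
  tfae_have 3 → 1 := three_one hT hcon P
  tfae_have 1 → 4 := one_four hT
  tfae_have 4 → 5 := four_five
  tfae_have 5 → 1 := five_one hT hcon
  tfae_have 1 → 6 := one_six hT P
  tfae_have 6 → 1 := six_one hT hcon P
  tfae_finish

end ModalArith
end
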